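/- For all nonzero integers M and all integers N ≥ N_2, one has 1 < |e^{s/t} − M/N| · c_2 · N^{2 + 2·log(|s|/α)·(1+ρ·ε(N))/log log N} · (log N / log log N)^{2β+1}, where c_2 = 8γ²|s|^{2β+1}(1+d)^β(4t + d(6t+s²))/α^{2β+1} + gcd(2,s)·γ·s^{2(β−1)}·d·(d+d²)^β/(N_2²·α^{2(β−1)}·|e^{s/t}−1|), d = ((log N_2)^{1/4}/σ + β)^{−1}, and log N_2 = max{ log N_1, e^{4e}, σ^{−2}, β², (ρ(2β+1)/(2 log(|s|/α)))^{4/3} }. -/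

import Mathlib

open Real Finset

/-- `α = ∏_{p prime, p ∣ s} p^(1/(p-1))`. -/
noncomputable def alphaS (s : ℤ) : ℝ :=
  ∏ p ∈ s.natAbs.primeFactors, (p : ℝ) ^ ((1 : ℝ) / ((p : ℝ) - 1))

/-- `β` = number of odd primes dividing `s`. -/
def betaS (s : ℤ) : ℕ := (s.natAbs.primeFactors.erase 2).card

/-- `γ` = product of the odd primes dividing `s`. -/
def gammaS (s : ℤ) : ℕ := ∏ p ∈ s.natAbs.primeFactors.erase 2, p

/-- `σ = 4tα/(e s²)`. -/
noncomputable def sigmaS (s t : ℤ) : ℝ :=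
  4 * (t : ℝ) * alphaS s / (Real.exp 1 * (s : ℝ) ^ 2)

/-- `ρ = 7/3` if `σ ≥ 1`, and `ρ = 5 - 2 log σ` if `σ < 1`. -/
noncomputable def rhoS (s t : ℤ) : ℝ :=
  if sigmaS s t ≥ 1 then 7 / 3 else 5 - 2 * Real.log (sigmaS s t)

/-- `ε(N) = log log log N / log log N`. -/
noncomputable def epsN (N : ℝ) : ℝ :=
  Real.log (Real.log (Real.log N)) / Real.log (Real.log N)

/-- `η = max{√e |e^{s/t}-1| γ/(√2 σ^β) - 1/2, e/σ + β}`. -/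
noncomputable def etaS (s t : ℤ) : ℝ :=
  max (Real.sqrt (Real.exp 1) * |Real.exp ((s : ℝ) / (t : ℝ)) - 1| * (gammaS s : ℝ)
        / (Real.sqrt 2 * sigmaS s t ^ (betaS s)) - 1 / 2)
      (Real.exp 1 / sigmaS s t + (betaS s : ℝ))

/-- `log N₁ = max{(η-β) log(σ(η-β)), log(gcd(2,s)/|4s + 2(s-2t)(e^{s/t}-1)|)}`. -/
noncomputable def logN1 (s t : ℤ) : ℝ :=
  max ((etaS s t - (betaS s : ℝ)) * Real.log (sigmaS s t * (etaS s t - (betaS s : ℝ))))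
      (Real.log ((Int.gcd 2 s : ℝ)
        / |4 * (s : ℝ) + 2 * ((s : ℝ) - 2 * (t : ℝ)) * (Real.exp ((s : ℝ) / (t : ℝ)) - 1)|))

/-- `log N₂ = max{log N₁, e^{4e}, σ^{-2}, β², (ρ(2β+1)/(2 log(|s|/α)))^{4/3}}`. -/
noncomputable def logN2 (s t : ℤ) : ℝ :=
  max (max (max (max (logN1 s t) (Real.exp (4 * Real.exp 1))) ((sigmaS s t) ^ (-2 : ℤ)))
        ((betaS s : ℝ) ^ 2))
      ((rhoS s t * (2 * (betaS s : ℝ) + 1) / (2 * Real.log (|(s : ℝ)| / alphaS s)))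
        ^ ((4 : ℝ) / 3))

/-- `d = ((log N₂)^{1/4}/σ + β)⁻¹`. -/
noncomputable def dS (s t : ℤ) : ℝ :=
  ((logN2 s t) ^ ((1 : ℝ) / 4) / sigmaS s t + (betaS s : ℝ))⁻¹

/-- the constant `c₂`. -/
noncomputable def c2S (s t : ℤ) : ℝ :=
  8 * (gammaS s : ℝ) ^ 2 * |(s : ℝ)| ^ (2 * betaS s + 1) * (1 + dS s t) ^ (betaS s)
      * (4 * (t : ℝ) + dS s t * (6 * (t : ℝ) + (s : ℝ) ^ 2))
      / (alphaS s) ^ (2 * betaS s + 1)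
    + (Int.gcd 2 s : ℝ) * (gammaS s : ℝ) * (s : ℝ) ^ (2 * ((betaS s : ℤ) - 1)) * dS s t
      * (dS s t + dS s t ^ 2) ^ (betaS s)
      / ((Real.exp (logN2 s t)) ^ 2 * (alphaS s) ^ (2 * ((betaS s : ℤ) - 1))
          * |Real.exp ((s : ℝ) / (t : ℝ)) - 1|)


def padC (k j : ℕ) : ℕ := (2 * j + k).choose j * (k + j).descFactorial j

lemma padC_mul_fact (k j : ℕ) :
    padC k j * Nat.factorial k = (2 * j + k).choose j * Nat.factorial (k + j) := by
  have h := Nat.factorial_mul_descFactorial (n := k + j) (k := j) (by omega)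
  simp only [Nat.add_sub_cancel] at h
  unfold padC
  rw [← h]; ring

lemma padC_mul_fact_fact (k j : ℕ) :
    padC k j * Nat.factorial k * Nat.factorial j = Nat.factorial (2 * j + k) := by
  rw [padC_mul_fact]
  have h := Nat.choose_mul_factorial_mul_factorial (n := 2 * j + k) (k := j) (by omega)
  rw [← h, show 2 * j + k - j = k + j by omega]; ring

lemma padC_rec (k j : ℕ) :
    padC (k + 2) (j + 1) = (4 * (k + j) + 10) * padC (k + 2) j + padC k (j + 1) := by
  have h1 := padC_mul_fact_fact (k + 2) (j + 1)
  have h2 := padC_mul_fact_fact (k + 2) j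
  have h3 := padC_mul_fact_fact k (j + 1)
  have hp : 0 < Nat.factorial (k + 2) * Nat.factorial (j + 1) := by positivity
  apply Nat.eq_of_mul_eq_mul_right hp
  rw [show 2 * (j + 1) + (k + 2) = (2 * j + (k + 2)) + 1 + 1 by ring] at h1
  rw [show 2 * (j + 1) + k = (2 * j + (k + 2)) by ring] at h3
  simp only [Nat.factorial_succ] at *
  generalize Nat.factorial k = a at *
  generalize Nat.factorial j = b at *
  generalize padC (k+2) (j+1) = x at *
  generalize padC (k+2) (j) = y at *
  generalize padC (k) (j+1) = z at *
  zify at *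
  linear_combination h1 + (- (4 * (k + j) + 10) * (j+1) : ℤ) * h2 - ((k+2)*(k+1) : ℤ) * h3

lemma padC_zero_right (k : ℕ) : padC k 0 = 1 := by simp [padC]

lemma padC_rec0 (j : ℕ) : padC 0 (j + 1) = (4 * j + 2) * padC 0 j := by
  have h1 := padC_mul_fact_fact 0 (j + 1)
  have h2 := padC_mul_fact_fact 0 j
  have hp : 0 < Nat.factorial (j + 1) := by positivity
  apply Nat.eq_of_mul_eq_mul_right hp
  rw [show 2 * (j + 1) + 0 = (2 * j + 0) + 1 + 1 by ring] at h1
  simp only [Nat.factorial_succ, Nat.factorial_zero] at *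
  zify at *
  linear_combination h1 - ((4 * j + 2) * (j+1) : ℤ) * h2

lemma padC_rec1 (j : ℕ) : padC 1 (j + 1) = (4 * j + 6) * padC 1 j := by
  have h1 := padC_mul_fact_fact 1 (j + 1)
  have h2 := padC_mul_fact_fact 1 j
  have hp : 0 < Nat.factorial (j + 1) := by positivity
  apply Nat.eq_of_mul_eq_mul_right hp
  rw [show 2 * (j + 1) + 1 = (2 * j + 1) + 1 + 1 by ring] at h1
  simp only [Nat.factorial_succ, Nat.factorial_zero] at *
  zify at *
  linear_combination h1 - ((4 * j + 6) * (j+1) : ℤ) * h2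

/-- Padé numerators. -/
def padP (a t : ℤ) : ℕ → ℤ
  | 0 => 1
  | 1 => 2 * t + a
  | (n + 2) => (4 * (n : ℤ) + 6) * t * padP a t (n + 1) + a ^ 2 * padP a t n

def auxH (a t : ℤ) (n : ℕ) : ℕ × ℕ → ℤ
  | (_, 0) => 0
  | (i, j + 1) => (4 * (n : ℤ) + 6) * padC i j * a ^ i * t ^ (j + 1)

def auxG (a t : ℤ) : ℕ × ℕ → ℤ
  | (0, _) => 0
  | (1, _) => 0
  | (i + 2, j) => padC i j * a ^ (i + 2) * t ^ j

lemma padP_eq (a t : ℤ) (n : ℕ) :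
    padP a t n = ∑ x ∈ HasAntidiagonal.antidiagonal n, (padC x.1 x.2 : ℤ) * a ^ x.1 * t ^ x.2 := by
  induction n using Nat.strong_induction_on with
  | _ n ih =>
  match n, ih with
  | 0, _ => simp [padP, padC]
  | 1, _ =>
    simp [padP, padC, Finset.Nat.antidiagonal_succ]
  | n + 2, ih =>
    have e1 : ∑ x ∈ HasAntidiagonal.antidiagonal (n + 2), auxH a t n x
        = (4 * (n : ℤ) + 6) * t * padP a t (n + 1) := by
      rw [Finset.Nat.sum_antidiagonal_succ', ih (n + 1) (by omega), Finset.mul_sum]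
      simp only [auxH, zero_add]
      apply Finset.sum_congr rfl
      intro x _
      ring
    have e2 : ∑ x ∈ HasAntidiagonal.antidiagonal (n + 2), auxG a t x = a ^ 2 * padP a t n := by
      rw [Finset.Nat.sum_antidiagonal_succ, Finset.Nat.sum_antidiagonal_succ, ih n (by omega),
        Finset.mul_sum]
      simp only [auxG, zero_add]
      apply Finset.sum_congr rfl
      intro x _
      ring
    rw [padP, ← e1, ← e2, ← Finset.sum_add_distrib]
    apply Finset.sum_congr rfl
    rintro ⟨i, j⟩ hx
    simp only [HasAntidiagonal.mem_antidiagonal] at hx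
    match i, j, hx with
    | 0, j + 1, hx =>
      have : j = n + 1 := by omega
      subst this
      simp only [auxH, auxG, padC_rec0]; push_cast; ring
    | 1, j + 1, hx =>
      have : j = n := by omega
      subst this
      simp only [auxH, auxG, padC_rec1]; push_cast; ring
    | i + 2, 0, hx => simp [auxH, auxG, padC_zero_right]
    | i + 2, j + 1, hx =>
      have : n = i + j + 1 := by omega
      subst this
      simp only [auxH, auxG, padC_rec]; push_cast; ring

/-- exponent of `p` in the common divisor. -/
def expo (p n : ℕ) : ℕ := if p = 2 then n else (Nat.factorial n).factorization p

lemma two_pow_dvd (a t : ℤ) (ha : 2 ∣ a) (n : ℕ) : (2 : ℤ) ^ n ∣ padP a t n := by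
  induction n using Nat.strong_induction_on with
  | _ n ih =>
  match n, ih with
  | 0, _ => simp [padP]
  | 1, _ => simpa [padP] using ha
  | n + 2, ih =>
    rw [padP]
    apply dvd_add
    · obtain ⟨c, hc⟩ := ih (n + 1) (by omega)
      rw [hc]
      exact ⟨(2 * n + 3) * t * c, by ring⟩
    · obtain ⟨c, hc⟩ := ih n (by omega)
      obtain ⟨b, rfl⟩ := ha
      rw [hc]
      exact ⟨b ^ 2 * c, by ring⟩

lemma fact_factorization_le (p k : ℕ) (hp : p.Prime) :
    (Nat.factorial k).factorization p ≤ k := by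
  have := Fact.mk hp
  have h := sub_one_mul_padicValNat_factorial (p := p) k
  rw [Nat.factorization_def _ hp]
  have h2 : 1 ≤ p - 1 := by have := hp.two_le; omega
  calc padicValNat p k.factorial ≤ (p - 1) * padicValNat p k.factorial :=
        Nat.le_mul_of_pos_left _ h2
    _ ≤ k := by rw [h]; omega

lemma padC_pos (k j : ℕ) : 0 < padC k j := by
  have := padC_mul_fact_fact k j
  rcases Nat.eq_zero_or_pos (padC k j) with h | h
  · rw [h] at this; simp at this; have := Nat.factorial_pos (2 * j + k); omega
  · exact h

lemma odd_pow_dvd (p : ℕ) (hp : p.Prime) (a t : ℤ) (ha : (p : ℤ) ∣ a) (n : ℕ) :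
    (p : ℤ) ^ ((Nat.factorial n).factorization p) ∣ padP a t n := by
  rw [padP_eq]
  apply Finset.dvd_sum
  rintro ⟨k, j⟩ hx
  simp only [HasAntidiagonal.mem_antidiagonal] at hx
  apply Dvd.dvd.mul_right
  have h1 : (Nat.factorial n).factorization p ≤ (padC k j).factorization p + k := by
    have hd : Nat.factorial n ∣ padC k j * Nat.factorial k := by
      rw [padC_mul_fact, hx]; exact dvd_mul_left _ _
    have hne : padC k j * Nat.factorial k ≠ 0 :=
      mul_ne_zero (padC_pos k j).ne' (Nat.factorial_ne_zero k)
    have h2 := (Nat.factorization_le_iff_dvd (Nat.factorial_ne_zero n) hne).2 hd p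
    rw [Nat.factorization_mul (padC_pos k j).ne' (Nat.factorial_ne_zero k)] at h2
    have h3 := fact_factorization_le p k hp
    simp only [Finsupp.add_apply] at h2
    omega
  refine (pow_dvd_pow _ h1).trans ?_
  rw [pow_add]
  apply mul_dvd_mul
  · have := Nat.ordProj_dvd (padC k j) p
    exact_mod_cast this
  · exact pow_dvd_pow_of_dvd ha k

lemma expo_dvd (p : ℕ) (hp : p.Prime) (a t : ℤ) (ha : (p : ℤ) ∣ a) (n : ℕ) :
    (p : ℤ) ^ (expo p n) ∣ padP a t n := by
  unfold expo
  split_ifs with h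
  · subst h; exact two_pow_dvd a t ha n
  · exact odd_pow_dvd p hp a t ha n

def padD (s : ℤ) (n : ℕ) : ℕ := ∏ p ∈ s.natAbs.primeFactors, p ^ (expo p n)

lemma padD_dvd (s a t : ℤ) (hsa : a.natAbs = s.natAbs) (n : ℕ) :
    (padD s n : ℤ) ∣ padP a t n := by
  unfold padD
  push_cast
  apply Finset.prod_dvd_of_coprime
  · intro p hp q hq hpq
    have hp' := Nat.prime_of_mem_primeFactors hp
    have hq' := Nat.prime_of_mem_primeFactors hq
    have : Nat.Coprime p q := (Nat.coprime_primes hp' hq').2 hpq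
    have h2 := this.isCoprime
    exact h2.pow
  · intro p hp
    apply expo_dvd p (Nat.prime_of_mem_primeFactors hp)
    have := Nat.dvd_of_mem_primeFactors hp
    rw [← hsa] at this
    exact Int.natCast_dvd.2 this

lemma padD_pos (s : ℤ) (n : ℕ) : 0 < padD s n := by
  apply Finset.prod_pos
  intro p hp
  exact pow_pos (Nat.prime_of_mem_primeFactors hp).pos _

lemma padD_mono (s : ℤ) (n : ℕ) : padD s n ≤ padD s (n + 1) := by
  apply Finset.prod_le_prod'
  intro p hp
  have hp' := Nat.prime_of_mem_primeFactors hp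
  apply Nat.pow_le_pow_right hp'.pos
  unfold expo
  split_ifs
  · omega
  · exact (Nat.factorization_le_iff_dvd (Nat.factorial_ne_zero n)
      (Nat.factorial_ne_zero (n+1))).2 (Nat.factorial_dvd_factorial (by omega)) p

lemma padD_one (s : ℤ) (hs : s ≠ 0) : padD s 1 = Int.gcd 2 s := by
  unfold padD
  have h0 : ∀ p ∈ s.natAbs.primeFactors, p ^ (expo p 1) = if p = 2 then 2 else 1 := by
    intro p hp
    unfold expo
    split_ifs with h <;> simp [h]
  rw [Finset.prod_congr rfl h0]
  rw [Finset.prod_ite_eq']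
  have h1 : s.natAbs ≠ 0 := by simpa using hs
  by_cases h : 2 ∣ s.natAbs
  · rw [if_pos (by simp [h1, h, Nat.prime_two])]
    have := Nat.gcd_eq_left h
    exact this.symm
  · rw [if_neg (by simp [h])]
    have := (Nat.Prime.coprime_iff_not_dvd Nat.prime_two).2 h
    exact (Nat.Coprime.gcd_eq_one this).symm

/-- the integral in the remainder. -/
noncomputable def padI (x : ℝ) (n : ℕ) : ℝ :=
  ∫ u in (0:ℝ)..1, (u * (1 - u)) ^ n * Real.exp (x * u)

lemma padI_integrable (x : ℝ) (n : ℕ) (a b : ℝ) :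
    IntervalIntegrable (fun u : ℝ => (u * (1 - u)) ^ n * Real.exp (x * u))
      MeasureTheory.volume a b := by
  apply Continuous.intervalIntegrable
  fun_prop

lemma padI_zero (x : ℝ) : x * padI x 0 = Real.exp x - 1 := by
  unfold padI
  rw [← intervalIntegral.integral_const_mul]
  have := intervalIntegral.integral_eq_sub_of_hasDerivAt (a := 0) (b := 1)
    (f := fun u : ℝ => Real.exp (x * u)) (f' := fun u => x * ((u * (1 - u)) ^ 0 * Real.exp (x * u)))
    (by
      intro u _
      have h := ((hasDerivAt_id u).const_mul x).exp
      refine HasDerivAt.congr_deriv h ?_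
      simp; ring)
    (by apply Continuous.intervalIntegrable; fun_prop)
  rw [this]; simp

lemma padI_one (x : ℝ) : x ^ 2 * padI x 1 + 2 * padI x 0 = Real.exp x + 1 := by
  unfold padI
  rw [← intervalIntegral.integral_const_mul, ← intervalIntegral.integral_const_mul,
    ← intervalIntegral.integral_add ((padI_integrable x 1 0 1).const_mul _)
      ((padI_integrable x 0 0 1).const_mul _)]
  have := intervalIntegral.integral_eq_sub_of_hasDerivAt (a := 0) (b := 1)
    (f := fun u : ℝ => (x * (u * (1 - u)) - (1 - 2 * u)) * Real.exp (x * u))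
    (f' := fun u => x ^ 2 * ((u * (1 - u)) ^ 1 * Real.exp (x * u))
      + 2 * ((u * (1 - u)) ^ 0 * Real.exp (x * u)))
    (by
      intro u _
      have h := ((hasDerivAt_id u).const_mul x).exp
      have h1 := (hasDerivAt_id u).mul ((hasDerivAt_id u).const_sub 1)
      have h2 := (h1.const_mul x).sub (((hasDerivAt_id u).const_mul 2).const_sub 1)
      have h3 := h2.mul h
      refine HasDerivAt.congr_deriv h3 ?_
      simp; ring)
    (by apply Continuous.intervalIntegrable; fun_prop)
  rw [this]; simp; ring

lemma padI_rec (x : ℝ) (n : ℕ) :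
    x ^ 2 * padI x (n + 2)
      = ((n : ℝ) + 2) * ((n : ℝ) + 1) * padI x n
        - ((n : ℝ) + 2) * (4 * (n : ℝ) + 6) * padI x (n + 1) := by
  have key : x ^ 2 * padI x (n + 2) + (((n : ℝ) + 2) * (4 * (n : ℝ) + 6) * padI x (n + 1)
      + (-(((n : ℝ) + 2) * ((n : ℝ) + 1))) * padI x n) = 0 := by
    unfold padI
    rw [← intervalIntegral.integral_const_mul, ← intervalIntegral.integral_const_mul,
      ← intervalIntegral.integral_const_mul,
      ← intervalIntegral.integral_add ((padI_integrable x (n+1) 0 1).const_mul _)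
        ((padI_integrable x n 0 1).const_mul _),
      ← intervalIntegral.integral_add ((padI_integrable x (n+2) 0 1).const_mul _)
        (((padI_integrable x (n+1) 0 1).const_mul _).add
        ((padI_integrable x n 0 1).const_mul _))]
    have := intervalIntegral.integral_eq_sub_of_hasDerivAt (a := 0) (b := 1)
      (f := fun u : ℝ => (x * (u * (1 - u)) ^ (n + 2)
        - ((n : ℝ) + 2) * (u * (1 - u)) ^ (n + 1) * (1 - 2 * u)) * Real.exp (x * u))
      (f' := fun u => x ^ 2 * ((u * (1 - u)) ^ (n + 2) * Real.exp (x * u))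
        + (((n : ℝ) + 2) * (4 * (n : ℝ) + 6) * ((u * (1 - u)) ^ (n + 1) * Real.exp (x * u))
        + (-(((n : ℝ) + 2) * ((n : ℝ) + 1))) * ((u * (1 - u)) ^ n * Real.exp (x * u))))
      (by
        intro u _
        have h := ((hasDerivAt_id u).const_mul x).exp
        have h1 := (hasDerivAt_id u).mul ((hasDerivAt_id u).const_sub 1)
        have h4 := (h1.pow (n + 2)).const_mul x
        have h5 := ((h1.pow (n + 1)).const_mul ((n : ℝ) + 2)).mul
          (((hasDerivAt_id u).const_mul 2).const_sub 1)
        have h3 := (h4.sub h5).mul h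
        refine HasDerivAt.congr_deriv h3 ?_
        simp
        ring)
      (by apply Continuous.intervalIntegrable; fun_prop)
    rw [this]; simp
  linarith

lemma padI_pos (x : ℝ) (n : ℕ) : 0 < padI x n := by
  unfold padI
  apply intervalIntegral.intervalIntegral_pos_of_pos_on (padI_integrable x n 0 1)
  · intro u hu
    have h1 := hu.1
    have h2 : 0 < 1 - u := by linarith [hu.2]
    positivity
  · norm_num

lemma padI_le (x : ℝ) (n : ℕ) : padI x (n + 1) ≤ padI x n / 4 := by
  have : padI x n / 4 = ∫ u in (0:ℝ)..1, (1 / 4) * ((u * (1 - u)) ^ n * Real.exp (x * u)) := by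
    rw [intervalIntegral.integral_const_mul]; unfold padI; ring
  rw [this]
  unfold padI
  apply intervalIntegral.integral_mono_on (by norm_num) (padI_integrable x (n+1) 0 1)
    ((padI_integrable x n 0 1).const_mul _)
  intro u hu
  have h1 := hu.1
  have h2 : 0 ≤ 1 - u := by linarith [hu.2]
  have h3 : u * (1 - u) ≤ 1 / 4 := by nlinarith [sq_nonneg (u - 1/2)]
  have h4 : 0 ≤ (u * (1 - u)) ^ n * Real.exp (x * u) := by positivity
  calc (u * (1 - u)) ^ (n + 1) * Real.exp (x * u)
      = (u * (1 - u)) * ((u * (1 - u)) ^ n * Real.exp (x * u)) := by ring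
    _ ≤ _ := by gcongr

/-- signed remainder -/
noncomputable def padR (s t : ℤ) (n : ℕ) : ℝ :=
  (s : ℝ) ^ (2 * n + 1) / ((t : ℝ) ^ (n + 1) * (Nat.factorial n : ℝ)) * padI ((s : ℝ) / t) n

lemma padR_zero (s t : ℤ) (_ht : 0 < t) :
    padR s t 0 = Real.exp ((s : ℝ) / t) - 1 := by
  rw [← padI_zero]; unfold padR; simp

lemma padR_one (s t : ℤ) (ht : 0 < t) :
    padR s t 1 = s * (Real.exp ((s : ℝ) / t) + 1) - 2 * t * (Real.exp ((s : ℝ) / t) - 1) := by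
  have ht' : (t : ℝ) ≠ 0 := by exact_mod_cast ht.ne'
  rw [← padI_zero, ← padI_one]; unfold padR; simp
  field_simp
  ring

lemma padR_rec (s t : ℤ) (ht : 0 < t) (n : ℕ) :
    padR s t (n + 2) = - ((4 * (n : ℝ) + 6) * t * padR s t (n + 1)) + (s:ℝ) ^ 2 * padR s t n := by
  have ht' : (t : ℝ) ≠ 0 := by exact_mod_cast ht.ne'
  have h := padI_rec ((s : ℝ) / t) n
  have e : padR s t (n + 2) = (s : ℝ) ^ (2 * n + 3) / ((t : ℝ) ^ (n + 1) * (Nat.factorial (n+2) : ℝ))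
      * (((s : ℝ) / t) ^ 2 * padI ((s : ℝ) / t) (n + 2)) := by
    unfold padR; field_simp; ring
  rw [e, h]; unfold padR
  simp only [Nat.factorial_succ]
  push_cast
  have : (Nat.factorial n : ℝ) ≠ 0 := by positivity
  have h1 : (n : ℝ) + 1 ≠ 0 := by positivity
  have h2 : (n : ℝ) + 1 + 1 ≠ 0 := by positivity
  field_simp
  ring

lemma pad_lin (s t : ℤ) (ht : 0 < t) (n : ℕ) :
    (padP (-s) t n : ℝ) * Real.exp ((s : ℝ) / t) - padP s t n = (-1) ^ n * padR s t n := by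
  induction n using Nat.strong_induction_on with
  | _ n ih =>
  match n, ih with
  | 0, _ => simp [padP, padR_zero s t ht]
  | 1, _ => simp [padP, padR_one s t ht]; ring
  | n + 2, ih =>
    have h1 := ih (n + 1) (by omega)
    have h0 := ih n (by omega)
    rw [padR_rec s t ht]
    simp only [padP]
    push_cast
    linear_combination (4 * (n : ℝ) + 6) * t * h1 + (s : ℝ) ^ 2 * h0

lemma pad_det (s t : ℤ) (n : ℕ) :
    padP (-s) t n * padP s t (n + 1) - padP (-s) t (n + 1) * padP s t n
      = (-1) ^ n * 2 * s ^ (2 * n + 1) := by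
  induction n with
  | zero => simp [padP]; ring
  | succ n ih =>
    simp only [padP]
    linear_combination (-s ^ 2) * ih

/-- absolute remainder -/
noncomputable def padA (s t : ℤ) (n : ℕ) : ℝ := |padR s t n|

lemma padA_eq (s t : ℤ) (ht : 0 < t) (n : ℕ) : padA s t n =
    |(s : ℝ)| ^ (2 * n + 1) / ((t : ℝ) ^ (n + 1) * (Nat.factorial n : ℝ)) * padI ((s : ℝ) / t) n := by
  have ht' : (0 : ℝ) < t := by exact_mod_cast ht
  unfold padA padR
  rw [abs_mul, abs_div, abs_pow, abs_of_pos (padI_pos _ _), abs_of_pos (a := (t:ℝ)^(n+1) * _) (by positivity)]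

lemma padA_pos (s t : ℤ) (hs : s ≠ 0) (ht : 0 < t) (n : ℕ) : 0 < padA s t n := by
  have ht' : (0 : ℝ) < t := by exact_mod_cast ht
  have hs' : (s : ℝ) ≠ 0 := by exact_mod_cast hs
  rw [padA_eq s t ht]
  have := padI_pos ((s : ℝ) / t) n
  positivity

lemma padA_succ (s t : ℤ) (ht : 0 < t) (n : ℕ) :
    padA s t (n + 1) ≤ (s : ℝ) ^ 2 / (4 * t * (n + 1)) * padA s t n := by
  have ht' : (0 : ℝ) < t := by exact_mod_cast ht
  rw [padA_eq s t ht, padA_eq s t ht]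
  have h := padI_le ((s : ℝ) / t) n
  calc _ ≤ |(s : ℝ)| ^ (2 * (n + 1) + 1) / ((t : ℝ) ^ (n + 1 + 1) * (Nat.factorial (n + 1) : ℝ)) *
        (padI ((s : ℝ) / t) n / 4) := by gcongr
    _ = _ := by
      rw [← sq_abs (s : ℝ), Nat.factorial_succ]
      push_cast
      field_simp
      ring

lemma padA_le (s t : ℤ) (ht : 0 < t) (n : ℕ) :
    padA s t n ≤ ((s : ℝ) ^ 2 / (4 * t)) ^ n / (Nat.factorial n : ℝ)
      * |Real.exp ((s : ℝ) / t) - 1| := by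
  have ht' : (0 : ℝ) < t := by exact_mod_cast ht
  induction n with
  | zero => simp [padA, padR_zero s t ht]
  | succ n ih =>
    refine (padA_succ s t ht n).trans ?_
    calc _ ≤ (s : ℝ) ^ 2 / (4 * t * (n + 1)) * (((s : ℝ) ^ 2 / (4 * t)) ^ n / (Nat.factorial n : ℝ)
      * |Real.exp ((s : ℝ) / t) - 1|) := by gcongr
      _ = _ := by
        rw [Nat.factorial_succ]; push_cast
        rw [show (s : ℝ) ^ 2 / (4 * t * (n + 1)) = ((s : ℝ) ^ 2 / (4 * t)) / (n + 1) by field_simp]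
        generalize (s : ℝ) ^ 2 / (4 * t) = y
        field_simp
        ring

lemma prime_lower (p n : ℕ) (hp : p.Prime) (hn : 1 ≤ n) :
    ((p : ℝ) ^ ((1 : ℝ) / ((p : ℝ) - 1))) ^ n
      ≤ (p : ℝ) ^ ((Nat.factorial n).factorization p) * ((p : ℝ) * n) := by
  have := Fact.mk hp
  have hp2 := hp.two_le
  have h := sub_one_mul_padicValNat_factorial (p := p) n
  have hle : (p.digits n).sum ≤ (Nat.log p n + 1) * (p - 1) := by
    have h1 := List.sum_le_card_nsmul (p.digits n) (p - 1) (by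
      intro x hx
      have := Nat.digits_lt_base (by omega : 1 < p) hx
      omega)
    rw [Nat.length_digits p n (by omega) (by omega)] at h1
    simpa using h1
  have hle2 : n ≤ (p - 1) * ((Nat.factorial n).factorization p + (Nat.log p n + 1)) := by
    rw [Nat.factorization_def _ hp, mul_add, h, mul_comm (p - 1)]
    omega
  have hpr : (0 : ℝ) < (p : ℝ) - 1 := by
    have : (2 : ℝ) ≤ p := by exact_mod_cast hp2
    linarith
  have hle3 : (n : ℝ) / ((p : ℝ) - 1) ≤ (((Nat.factorial n).factorization p + (Nat.log p n + 1) : ℕ) : ℝ) := by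
    rw [div_le_iff₀ hpr]
    have : ((n : ℕ) : ℝ) ≤ (((p - 1) * ((Nat.factorial n).factorization p + (Nat.log p n + 1)) : ℕ) : ℝ) := by
      exact_mod_cast hle2
    rw [Nat.cast_mul, Nat.cast_sub (by omega)] at this
    push_cast at *
    linarith
  have hp1 : (1 : ℝ) ≤ p := by exact_mod_cast hp.one_le
  calc ((p : ℝ) ^ ((1 : ℝ) / ((p : ℝ) - 1))) ^ n = (p : ℝ) ^ ((n : ℝ) / ((p : ℝ) - 1)) := by
        rw [← Real.rpow_natCast, ← Real.rpow_mul (by positivity)]; congr 1; field_simp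
    _ ≤ (p : ℝ) ^ ((((Nat.factorial n).factorization p + (Nat.log p n + 1) : ℕ) : ℝ)) :=
        Real.rpow_le_rpow_of_exponent_le hp1 hle3
    _ = (p : ℝ) ^ ((Nat.factorial n).factorization p) * ((p : ℝ) * (p : ℝ) ^ (Nat.log p n)) := by
        rw [Real.rpow_natCast]; ring
    _ ≤ _ := by
        have : ((p ^ (Nat.log p n) : ℕ) : ℝ) ≤ n := by
          exact_mod_cast Nat.pow_log_le_self p (by omega)
        push_cast at this
        gcongr

lemma padD_lower (s : ℤ) (n : ℕ) (hn : 1 ≤ n) :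
    (alphaS s) ^ n ≤ (padD s n : ℝ) * ((gammaS s : ℝ) * (n : ℝ) ^ (betaS s)) := by
  have h1 : (gammaS s : ℝ) * (n : ℝ) ^ (betaS s)
      = ∏ p ∈ s.natAbs.primeFactors, (if p = 2 then (1 : ℝ) else (p : ℝ) * n) := by
    rw [← Finset.prod_erase (a := 2) _ (by simp)]
    unfold gammaS betaS
    push_cast
    rw [← Finset.prod_const, ← Finset.prod_mul_distrib]
    apply Finset.prod_congr rfl
    intro p hp
    rw [if_neg (Finset.ne_of_mem_erase hp)]
  rw [h1]
  unfold alphaS padD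
  push_cast
  rw [← Finset.prod_mul_distrib, ← Finset.prod_pow]
  apply Finset.prod_le_prod
  · intro p _; positivity
  · intro p hp
    have hp' := Nat.prime_of_mem_primeFactors hp
    unfold expo
    split_ifs with h
    · subst h; norm_num
    · exact prime_lower p n hp' hn

lemma padP_pos (a t : ℤ) (ha : 0 < a) (ht : 0 < t) (n : ℕ) : 0 < padP a t n := by
  induction n using Nat.strong_induction_on with
  | _ n ih =>
  match n, ih with
  | 0, _ => simp [padP]
  | 1, _ => simp only [padP]; positivity
  | n + 2, ih =>
    have h1 := ih (n + 1) (by omega)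
    have h0 := ih n (by omega)
    rw [padP]; positivity

lemma padP_growth (a t : ℤ) (ha : 0 < a) (ht : 0 < t) (n : ℕ) :
    (4 * (n : ℤ) + 2) * t * padP a t n ≤ padP a t (n + 1) := by
  cases n with
  | zero => simp [padP]; omega
  | succ n =>
    have h0 := padP_pos a t ha ht n
    rw [padP]
    have : 0 ≤ a ^ 2 * padP a t n := by positivity
    push_cast
    linarith

lemma padP_upper (a t : ℤ) (ha : 0 < a) (ht : 0 < t) (n : ℕ) :
    (padP a t (n + 2) : ℝ) ≤ ((4 * (n : ℝ) + 6) * t + (a : ℝ) ^ 2 / ((4 * n + 2) * t))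
      * padP a t (n + 1) := by
  have ht' : (0 : ℝ) < t := by exact_mod_cast ht
  have h := padP_growth a t ha ht n
  have h' : (4 * (n : ℝ) + 2) * t * padP a t n ≤ padP a t (n + 1) := by exact_mod_cast h
  have h2 : (padP a t n : ℝ) ≤ padP a t (n + 1) / ((4 * (n : ℝ) + 2) * t) := by
    rw [le_div_iff₀ (by positivity)]; linarith
  rw [padP]; push_cast
  calc _ ≤ (4 * (n : ℝ) + 6) * t * padP a t (n + 1) + (a : ℝ) ^ 2 * (padP a t (n + 1) / ((4 * (n : ℝ) + 2) * t)) := by gcongr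
    _ = _ := by ring

lemma padR_sign_pos (s t : ℤ) (hs : 0 < s) (ht : 0 < t) (n : ℕ) : padR s t n = padA s t n := by
  have ht' : (0 : ℝ) < t := by exact_mod_cast ht
  have hs' : (0 : ℝ) < s := by exact_mod_cast hs
  rw [padA, abs_of_pos]
  unfold padR
  have := padI_pos ((s : ℝ) / t) n
  positivity

lemma padR_sign_neg (s t : ℤ) (hs : s < 0) (ht : 0 < t) (n : ℕ) : padR s t n = - padA s t n := by
  have hs' : (s : ℝ) < 0 := by exact_mod_cast hs
  rw [padA_eq s t ht]
  unfold padR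
  rw [abs_of_neg hs', Odd.neg_pow (by simp)]
  ring

lemma pad_id (s t : ℤ) (ht : 0 < t) (m : ℕ) :
    (padP (-s) t m : ℝ) * padR s t (m + 1) + padP (-s) t (m + 1) * padR s t m
      = 2 * (s : ℝ) ^ (2 * m + 1) := by
  have h1 := pad_lin s t ht m
  have h2 := pad_lin s t ht (m + 1)
  have h3 : (padP (-s) t m * padP s t (m + 1) - padP (-s) t (m + 1) * padP s t m : ℝ)
      = (-1) ^ m * 2 * s ^ (2 * m + 1) := by exact_mod_cast pad_det s t m
  have e : ((-1 : ℝ) ^ m) * ((-1 : ℝ) ^ m) = 1 := by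
    rw [← mul_pow]; simp
  rw [pow_succ] at h2
  generalize (-1 : ℝ) ^ m = z at *
  have : z * ((padP (-s) t m : ℝ) * padR s t (m + 1) + padP (-s) t (m + 1) * padR s t m)
    = z * (2 * (s : ℝ) ^ (2 * m + 1)) := by
    linear_combination h3 - (padP (-s) t (m+1) : ℝ) * h1 + (padP (-s) t m : ℝ) * h2
  have hz : z ≠ 0 := by rintro rfl; simp at e
  exact mul_left_cancel₀ hz this

lemma pad_F1 (s t : ℤ) (hs : s ≠ 0) (ht : 0 < t) (m : ℕ) :
    |(padP (-s) t (m + 1) : ℝ)| * padA s t m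
      ≤ 2 * |(s : ℝ)| ^ (2 * m + 1) + padA s t (m + 1) * padA s t m := by
  have p0 := padA_pos s t hs ht m
  have p1 := padA_pos s t hs ht (m + 1)
  have hid := pad_id s t ht m
  rcases lt_or_gt_of_ne hs with h | h
  · have q0 : (0 : ℝ) < padP (-s) t m := by exact_mod_cast padP_pos (-s) t (by omega) ht m
    have q1 : (0 : ℝ) < padP (-s) t (m + 1) := by exact_mod_cast padP_pos (-s) t (by omega) ht (m + 1)
    have h' : (s : ℝ) < 0 := by exact_mod_cast h
    rw [padR_sign_neg s t h ht, padR_sign_neg s t h ht] at hid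
    rw [abs_of_pos q1, abs_of_neg h', Odd.neg_pow (by simp)]
    nlinarith [mul_pos q0 p1, mul_pos p1 p0]
  · have q0 : (0 : ℝ) < padP s t m := by exact_mod_cast padP_pos s t h ht m
    have q1 : (0 : ℝ) < padP s t (m + 1) := by exact_mod_cast padP_pos s t h ht (m + 1)
    have h' : (0 : ℝ) < s := by exact_mod_cast h
    have ht' : (0 : ℝ) < t := by exact_mod_cast ht
    have l0 := pad_lin s t ht m
    have l1 := pad_lin s t ht (m + 1)
    rw [padR_sign_pos s t h ht] at hid l0 l1
    rw [padR_sign_pos s t h ht] at hid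
    rw [abs_of_pos h']
    have hE : 1 ≤ Real.exp ((s : ℝ) / t) := Real.one_le_exp (by positivity)
    rw [pow_succ] at l1
    generalize Real.exp ((s : ℝ) / t) = E at *
    have hid2 : (padP s t m : ℝ) * padA s t (m + 1) + padP s t (m + 1) * padA s t m
      = E * (2 * (s : ℝ) ^ (2 * m + 1)) := by
      linear_combination E * hid - padA s t (m + 1) * l0 - padA s t m * l1
    have hz : |(-1 : ℝ) ^ m * -1| = 1 := by rw [abs_mul, abs_pow]; simp
    have hA : |(padP (-s) t (m + 1) : ℝ)| * E ≤ padP s t (m + 1) + padA s t (m + 1) := by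
      rw [← abs_of_pos (by linarith : 0 < E), ← abs_mul]
      rw [show (padP (-s) t (m + 1) : ℝ) * E = padP s t (m + 1) + (-1) ^ m * -1 * padA s t (m + 1) by linarith]
      refine (abs_add_le _ _).trans ?_
      rw [abs_mul ((-1 : ℝ) ^ m * -1), hz, abs_of_pos q1, abs_of_pos p1]; simp
    have hfin : E * (|(padP (-s) t (m + 1) : ℝ)| * padA s t m) ≤ E * (2 * (s : ℝ) ^ (2 * m + 1) + padA s t (m + 1) * padA s t m) := by
      have := mul_le_mul_of_nonneg_right hA p0.le
      nlinarith [mul_pos q0 p1, mul_pos p1 p0]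
    exact le_of_mul_le_mul_left hfin (by linarith)

noncomputable def padK (s t : ℤ) (m : ℕ) : ℝ :=
  (4 * (m : ℝ) + 6) * t + (s : ℝ) ^ 2 / ((4 * m + 2) * t)

lemma pad_F2 (s t : ℤ) (hs : s ≠ 0) (ht : 0 < t) (m : ℕ) :
    |(padP (-s) t (m + 2) : ℝ)|
      ≤ padK s t m * |(padP (-s) t (m + 1) : ℝ)| + padK s t m * padA s t (m + 1) + padA s t (m + 2) := by
  have p0 := padA_pos s t hs ht (m + 1)
  have p1 := padA_pos s t hs ht (m + 2)
  have ht' : (0 : ℝ) < t := by exact_mod_cast ht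
  have hK : 0 < padK s t m := by unfold padK; positivity
  rcases lt_or_gt_of_ne hs with h | h
  · have q0 : (0 : ℝ) < padP (-s) t (m+2) := by exact_mod_cast padP_pos (-s) t (by omega) ht (m+2)
    have q1 : (0 : ℝ) < padP (-s) t (m + 1) := by exact_mod_cast padP_pos (-s) t (by omega) ht (m + 1)
    rw [abs_of_pos q0, abs_of_pos q1]
    have := padP_upper (-s) t (by omega) ht m
    push_cast at this
    rw [neg_sq] at this
    have h3 : 0 ≤ padK s t m * padA s t (m + 1) := by positivity
    unfold padK at *
    linarith
  · have q0 : (0 : ℝ) < padP s t (m + 2) := by exact_mod_cast padP_pos s t h ht (m + 2)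
    have q1 : (0 : ℝ) < padP s t (m + 1) := by exact_mod_cast padP_pos s t h ht (m + 1)
    have h' : (0 : ℝ) < s := by exact_mod_cast h
    have l0 := pad_lin s t ht (m + 1)
    have l1 := pad_lin s t ht (m + 2)
    rw [padR_sign_pos s t h ht] at l0 l1
    have hE : 1 ≤ Real.exp ((s : ℝ) / t) := Real.one_le_exp (by positivity)
    have hup : (padP s t (m + 2) : ℝ) ≤ padK s t m * padP s t (m + 1) := padP_upper s t h ht m
    generalize Real.exp ((s : ℝ) / t) = E at *
    have hz : ∀ k : ℕ, |(-1 : ℝ) ^ k| = 1 := by intro k; rw [abs_pow]; simp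
    have hA : |(padP (-s) t (m + 2) : ℝ)| * E ≤ padP s t (m + 2) + padA s t (m + 2) := by
      rw [← abs_of_pos (by linarith : 0 < E), ← abs_mul]
      rw [show (padP (-s) t (m + 2) : ℝ) * E = padP s t (m + 2) + (-1) ^ (m + 2) * padA s t (m + 2) by linarith]
      refine (abs_add_le _ _).trans ?_
      rw [abs_mul ((-1 : ℝ) ^ (m + 2)), hz, abs_of_pos q0, abs_of_pos p1]; simp
    have hB : (padP s t (m + 1) : ℝ) ≤ |(padP (-s) t (m + 1) : ℝ)| * E + padA s t (m + 1) := by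
      have e1 : (padP s t (m + 1) : ℝ) = (padP (-s) t (m + 1) : ℝ) * E + - ((-1) ^ (m + 1) * padA s t (m + 1)) := by linarith
      rw [e1]
      apply add_le_add
      · exact mul_le_mul_of_nonneg_right (le_abs_self _) (by linarith)
      · refine (le_abs_self _).trans ?_
        rw [abs_neg, abs_mul, hz, abs_of_pos p0]; simp
    have hfin : E * |(padP (-s) t (m + 2) : ℝ)| ≤ E * (padK s t m * |(padP (-s) t (m + 1) : ℝ)| + padK s t m * padA s t (m + 1) + padA s t (m + 2)) := by
      have h1 := mul_le_mul_of_nonneg_left hB hK.le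
      have h2 : padK s t m * padA s t (m + 1) ≤ E * (padK s t m * padA s t (m + 1)) := le_mul_of_one_le_left (by positivity) hE
      have h3 : padA s t (m + 2) ≤ E * padA s t (m + 2) := le_mul_of_one_le_left (by positivity) hE
      linarith
    exact le_of_mul_le_mul_left hfin (by linarith)

lemma pad_F3 (s t : ℤ) (hs : s ≠ 0) (ht : 0 < t) (n : ℕ) (hr : padA s t n < padD s n) :
    (padD s n : ℝ) ≤ |(padP (-s) t n : ℝ)| := by
  have hdv := padD_dvd s (-s) t (by simp) n
  have hdv2 := padD_dvd s s t rfl n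
  have hne : padP (-s) t n ≠ 0 := by
    rcases lt_or_gt_of_ne hs with h | h
    · exact (padP_pos (-s) t (by omega) ht n).ne'
    · intro h0
      have q1 := padP_pos s t h ht n
      have q2 : (padD s n : ℝ) ≤ padP s t n := by exact_mod_cast Int.le_of_dvd q1 hdv2
      have l0 := pad_lin s t ht n
      rw [h0] at l0
      have : |(padP s t n : ℝ)| = padA s t n := by
        have e : (padP s t n : ℝ) = -((-1) ^ n * padR s t n) := by push_cast at l0; linarith
        rw [e, abs_neg, abs_mul, abs_pow]; simp [padA]
      have := le_abs_self (padP s t n : ℝ)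
      linarith
  have := Int.le_of_dvd (abs_pos.2 hne) ((dvd_abs _ _).2 hdv)
  exact_mod_cast this

lemma pad_delta (s t : ℤ) (ht : 0 < t) (M N : ℤ) (hN : 0 < N) (n : ℕ)
    (hne : padP (-s) t n * M - padP s t n * N ≠ 0) :
    (padD s n : ℝ) ≤ |(padP (-s) t n : ℝ)| * (N * |Real.exp ((s : ℝ) / t) - M / N|)
      + N * padA s t n := by
  have hN' : (0 : ℝ) < N := by exact_mod_cast hN
  have hdv := padD_dvd s (-s) t (by simp) n
  have hdv2 := padD_dvd s s t rfl n
  have h1 := Int.le_of_dvd (abs_pos.2 hne) ((dvd_abs _ _).2 (dvd_sub (hdv.mul_right M) (hdv2.mul_right N)))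
  have h2 : (padD s n : ℝ) ≤ |(padP (-s) t n : ℝ) * M - padP s t n * N| := by exact_mod_cast h1
  have l0 := pad_lin s t ht n
  have e : (padP (-s) t n : ℝ) * M - padP s t n * N
      = -((padP (-s) t n : ℝ) * (N * (Real.exp ((s : ℝ) / t) - M / N))) + N * ((-1) ^ n * padR s t n) := by
    rw [← l0]; field_simp; ring
  rw [e] at h2
  refine h2.trans ((abs_add_le _ _).trans ?_)
  rw [abs_neg, abs_mul, abs_mul, abs_mul, abs_mul, abs_pow, abs_of_pos hN']
  simp [padA]

set_option maxHeartbeats 1600000 in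
lemma pad_core (s t : ℤ) (hs : s ≠ 0) (ht : 0 < t) (M N : ℤ) (hN : 0 < N) (m : ℕ) (c : ℝ)
    (hc : 1 ≤ c)
    (h0 : (padD s m : ℝ) ≤ 2 * (N * padA s t m))
    (h1 : 2 * (N * padA s t (m + 1)) ≤ padD s (m + 1))
    (h2 : 2 * (N * padA s t (m + 2)) ≤ padD s (m + 2))
    (h2' : c * (N * padA s t (m + 2)) ≤ (c - 1) * padD s (m + 2)) :
    1 - 1 / (2 * (N : ℝ)) ≤ c * |Real.exp ((s : ℝ) / t) - M / N| * (N : ℝ) ^ 2 *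
      (padK s t m * (1 + 1 / (2 * (N : ℝ))) + 1 / (2 * (N : ℝ))) *
      (4 * (|(s : ℝ)| ^ (2 * m + 1) / (padD s m * padD s (m + 1)))) := by
  have hN' : (1 : ℝ) ≤ N := by exact_mod_cast hN
  have ht' : (1 : ℝ) ≤ t := by exact_mod_cast ht
  have D0 : (0 : ℝ) < padD s m := by exact_mod_cast padD_pos s m
  have D1 : (0 : ℝ) < padD s (m + 1) := by exact_mod_cast padD_pos s (m + 1)
  have D2 : (0 : ℝ) < padD s (m + 2) := by exact_mod_cast padD_pos s (m + 2)
  have D12 : (padD s (m + 1) : ℝ) ≤ padD s (m + 2) := by exact_mod_cast padD_mono s (m + 1)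
  have p0 := padA_pos s t hs ht m
  have p1 := padA_pos s t hs ht (m + 1)
  have p2 := padA_pos s t hs ht (m + 2)
  have hK : 6 ≤ padK s t m := by
    unfold padK
    have e1 : 0 ≤ (s : ℝ) ^ 2 / ((4 * m + 2) * t) := by positivity
    have e2 : 6 * 1 ≤ (4 * (m : ℝ) + 6) * t := by gcongr; linarith [(Nat.cast_nonneg m : (0:ℝ) ≤ m)]
    linarith
  have f1 := pad_F1 s t hs ht m
  have f2 := pad_F2 s t hs ht m
  have f3 := pad_F3 s t hs ht (m + 1) (by nlinarith only [h1, hN', p1, D1])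
  have d1 := pad_delta s t ht M N hN (m + 1)
  have d2 := pad_delta s t ht M N hN (m + 2)
  have hdet := pad_det s t (m + 1)
  set h : ℝ := 1 / (2 * (N : ℝ)) with hh
  have hhN : 2 * (N : ℝ) * h = 1 := by rw [hh]; field_simp
  have hpos : 0 < h := by rw [hh]; positivity
  have hle : h ≤ 1 / 2 := by
    rw [hh]; apply one_div_le_one_div_of_le <;> linarith
  have N2 : 0 < 2 * (N : ℝ) := by linarith
  set δ := |Real.exp ((s : ℝ) / t) - M / N| with hδ
  have hδ0 : 0 ≤ δ := abs_nonneg _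
  set K := padK s t m
  -- normalised quantities
  set q := |(padP (-s) t (m + 1) : ℝ)| / padD s (m + 1) with hq
  have hqD : |(padP (-s) t (m + 1) : ℝ)| = q * padD s (m + 1) := by rw [hq]; field_simp
  set q2 := |(padP (-s) t (m + 2) : ℝ)| / padD s (m + 2) with hq2
  have hqD2 : |(padP (-s) t (m + 2) : ℝ)| = q2 * padD s (m + 2) := by rw [hq2]; field_simp
  set r0 := padA s t m / padD s m with hr0
  have hrD0 : padA s t m = r0 * padD s m := by rw [hr0]; field_simp
  set r1 := padA s t (m + 1) / padD s (m + 1) with hr1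
  have hrD1 : padA s t (m + 1) = r1 * padD s (m + 1) := by rw [hr1]; field_simp
  set r2 := padA s t (m + 2) / padD s (m + 2) with hr2
  have hrD2 : padA s t (m + 2) = r2 * padD s (m + 2) := by rw [hr2]; field_simp
  rw [hqD] at f1 f2 f3 d1
  rw [hqD2] at f2 d2
  rw [hrD0] at f1 h0
  rw [hrD1] at f1 f2 h1 d1
  rw [hrD2] at f2 h2 h2' d2
  have r0p : 0 < r0 := by rw [hr0]; positivity
  have r1p : 0 < r1 := by rw [hr1]; positivity
  have r2p : 0 < r2 := by rw [hr2]; positivity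
  have g0 : h ≤ r0 := by
    have : 1 ≤ 2 * (N * r0) := by
      refine le_of_mul_le_mul_right (a := (padD s m : ℝ)) ?_ D0
      linarith
    exact le_of_mul_le_mul_left (by linarith) N2
  have g1' : 2 * (N * r1) ≤ 1 := by
    refine le_of_mul_le_mul_right (a := (padD s (m+1) : ℝ)) ?_ D1
    linarith
  have g1 : r1 ≤ h := le_of_mul_le_mul_left (by linarith) N2
  have g2' : 2 * (N * r2) ≤ 1 := by
    refine le_of_mul_le_mul_right (a := (padD s (m+2) : ℝ)) ?_ D2
    linarith
  have g2 : r2 ≤ h := le_of_mul_le_mul_left (by linarith) N2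
  have g3 : c * (N * r2) ≤ c - 1 := by
    refine le_of_mul_le_mul_right (a := (padD s (m+2) : ℝ)) ?_ D2
    linarith
  have gq : 1 ≤ q := by
    refine le_of_mul_le_mul_right (a := (padD s (m+1) : ℝ)) ?_ D1
    linarith
  have ghq : h ≤ h * q := le_mul_of_one_le_right hpos.le gq
  have gq2 : q2 ≤ q * (K * (1 + h) + h) := by
    have e1 : q2 * padD s (m + 2) ≤ (K * q + K * r1 + r2) * padD s (m + 2) := by
      have : (K * q + K * r1) * padD s (m + 1) ≤ (K * q + K * r1) * padD s (m + 2) := by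
        apply mul_le_mul_of_nonneg_left D12; positivity
      linarith
    have e2 := le_of_mul_le_mul_right e1 D2
    have e3 : K * r1 ≤ K * (h * q) := by
      apply mul_le_mul_of_nonneg_left _ (by linarith)
      linarith
    have e4 : r2 ≤ h * q := by linarith
    linarith
  set T := |(s : ℝ)| ^ (2 * m + 1) / (padD s m * padD s (m + 1)) with hT
  have hTp : 0 ≤ T := by rw [hT]; positivity
  have gT : q * (1 - h) ≤ 4 * N * T := by
    have e1 : q * r0 ≤ 2 * T + r1 * r0 := by
      refine le_of_mul_le_mul_right (a := (padD s m * padD s (m+1) : ℝ)) ?_ (by positivity)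
      have : T * (padD s m * padD s (m+1)) = |(s : ℝ)| ^ (2 * m + 1) := by rw [hT]; field_simp
      linarith
    have e2 : r1 * r0 ≤ h * q * r0 := by
      apply mul_le_mul_of_nonneg_right _ r0p.le; linarith
    have e3 : q * (1 - h) * h ≤ q * (1 - h) * r0 := by
      apply mul_le_mul_of_nonneg_left g0; apply mul_nonneg <;> linarith
    have e4 : q * (1 - h) * h ≤ 2 * T := by linarith
    have e5 := mul_le_mul_of_nonneg_left e4 (by positivity : 0 ≤ 2 * (N : ℝ))
    have e6 : 2 * (N : ℝ) * (q * (1 - h) * h) = q * (1 - h) := by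
      linear_combination (q * (1 - h)) * hhN
    linarith
  have hKpos : 6 ≤ K * (1 + h) + h := by
    have : 0 ≤ K * h := mul_nonneg (by linarith) hpos.le
    linarith
  -- main dichotomy
  have main : 1 ≤ c * (N * δ) * (q * (K * (1 + h) + h)) := by
    by_cases hz : padP (-s) t (m + 1) * M - padP s t (m + 1) * N = 0
    · have hz2 : padP (-s) t (m + 2) * M - padP s t (m + 2) * N ≠ 0 := by
        intro hz2
        have : (-1) ^ (m+1) * 2 * s ^ (2 * (m + 1) + 1) * N = 0 := by
          rw [← hdet]
          linear_combination (padP (-s) t (m+2)) * hz - (padP (-s) t (m+1)) * hz2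
        simp [hs, hN.ne'] at this
      have e1 := d2 hz2
      have e2 : 1 ≤ q2 * (N * δ) + N * r2 := by
        refine le_of_mul_le_mul_right (a := (padD s (m+2) : ℝ)) ?_ D2
        linarith
      have e3 : q2 * (N * δ) ≤ q * (K * (1 + h) + h) * (N * δ) := by
        apply mul_le_mul_of_nonneg_right gq2; positivity
      have e4 : 1 ≤ c * (q2 * (N * δ)) := by
        have := mul_le_mul_of_nonneg_left e2 (by linarith : 0 ≤ c)
        linarith
      have e5 := mul_le_mul_of_nonneg_left e3 (by linarith : 0 ≤ c)
      linarith
    · have e1 := d1 hz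
      have e2 : 1 ≤ q * (N * δ) + N * r1 := by
        refine le_of_mul_le_mul_right (a := (padD s (m+1) : ℝ)) ?_ D1
        linarith
      have e3 : 1 / 2 ≤ q * (N * δ) := by linarith
      have e4 : 1 * (1 / 2 * 6) ≤ c * (q * (N * δ) * (K * (1 + h) + h)) := by gcongr
      linarith
  have e7 : (c * (N * δ) * (K * (1 + h) + h)) * (q * (1 - h)) ≤ (c * (N * δ) * (K * (1 + h) + h)) * (4 * N * T) := by
    apply mul_le_mul_of_nonneg_left gT
    apply mul_nonneg (mul_nonneg (by linarith) (by positivity)) (by linarith)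
  have e8 := mul_le_mul_of_nonneg_right main (by linarith : 0 ≤ 1 - h)
  calc 1 - h = 1 * (1 - h) := by ring
    _ ≤ _ := e8
    _ = (c * (N * δ) * (K * (1 + h) + h)) * (q * (1 - h)) := by ring
    _ ≤ _ := e7
    _ = _ := by ring

lemma alphaS_pos (s : ℤ) : 0 < alphaS s := by
  apply Finset.prod_pos
  intro p hp
  have := (Nat.prime_of_mem_primeFactors hp).pos
  positivity

lemma alphaS_lt (s : ℤ) (h3 : 3 ≤ s.natAbs) : alphaS s < |(s : ℝ)| := by
  have habs : |(s : ℝ)| = (s.natAbs : ℝ) := by rw [Nat.cast_natAbs]; simp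
  rw [habs]
  by_cases hex : ∃ p ∈ s.natAbs.primeFactors, p ≠ 2
  · obtain ⟨p, hp, hp2⟩ := hex
    have h1 : alphaS s < ∏ p ∈ s.natAbs.primeFactors, (p : ℝ) := by
      apply Finset.prod_lt_prod
      · intro q hq
        have := (Nat.prime_of_mem_primeFactors hq).pos
        positivity
      · intro q hq
        have h2 : (2 : ℝ) ≤ q := by exact_mod_cast (Nat.prime_of_mem_primeFactors hq).two_le
        calc (q : ℝ) ^ ((1 : ℝ) / ((q : ℝ) - 1)) ≤ (q : ℝ) ^ (1 : ℝ) := by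
              apply Real.rpow_le_rpow_of_exponent_le (by linarith)
              rw [div_le_one (by linarith)]; linarith
          _ = q := Real.rpow_one _
      · refine ⟨p, hp, ?_⟩
        have h2 : 3 ≤ p := by
          have := (Nat.prime_of_mem_primeFactors hp).two_le; omega
        have h2 : (3 : ℝ) ≤ p := by exact_mod_cast h2
        calc (p : ℝ) ^ ((1 : ℝ) / ((p : ℝ) - 1)) < (p : ℝ) ^ (1 : ℝ) := by
              apply Real.rpow_lt_rpow_of_exponent_lt (by linarith)
              rw [div_lt_one (by linarith)]; linarith
          _ = p := Real.rpow_one _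
    refine lt_of_lt_of_le h1 ?_
    have := Nat.le_of_dvd (by omega) (Nat.prod_primeFactors_dvd s.natAbs)
    have h : ((∏ p ∈ s.natAbs.primeFactors, p : ℕ) : ℝ) ≤ s.natAbs := by exact_mod_cast this
    push_cast at h
    exact h
  · push Not at hex
    have hsub : s.natAbs.primeFactors ⊆ {2} := by
      intro p hp; simpa using hex p hp
    have : alphaS s ≤ 2 := by
      rcases Finset.subset_singleton_iff.1 hsub with h | h
      · unfold alphaS; rw [h]; simp
      · unfold alphaS; rw [h]; norm_num
    have h3' : (3 : ℝ) ≤ s.natAbs := by exact_mod_cast h3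
    linarith

lemma small_s (s : ℤ) (hs : s ≠ 0) (h3 : s.natAbs < 3) :
    alphaS s = |(s : ℝ)| ∧ betaS s = 0 := by
  have habs : |(s : ℝ)| = (s.natAbs : ℝ) := by rw [Nat.cast_natAbs]; simp
  rw [habs]
  have h : s.natAbs = 1 ∨ s.natAbs = 2 := by omega
  unfold alphaS betaS
  rcases h with h | h
  · rw [h]; simp
  · rw [h, Nat.Prime.primeFactors Nat.prime_two]; norm_num

lemma small_sigmaS (s t : ℤ) (hs : s ≠ 0) (ht : 0 < t) (h3 : s.natAbs < 3) :
    2 ≤ sigmaS s t * Real.exp 1 := by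
  obtain ⟨ha, _⟩ := small_s s hs h3
  have ht' : (1 : ℝ) ≤ t := by exact_mod_cast ht
  have hs' : 0 < |(s : ℝ)| := by simpa using hs
  have h2 : |(s : ℝ)| ≤ 2 := by
    have habs : |(s : ℝ)| = (s.natAbs : ℝ) := by rw [Nat.cast_natAbs]; simp
    rw [habs]; exact_mod_cast (by omega : s.natAbs ≤ 2)
  unfold sigmaS
  rw [ha, ← sq_abs]
  have he := Real.exp_pos 1
  rw [show 4 * (t : ℝ) * |(s : ℝ)| / (Real.exp 1 * |(s : ℝ)| ^ 2) * Real.exp 1 = 4 * t / |(s : ℝ)| by field_simp]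
  rw [le_div_iff₀ hs']
  nlinarith

lemma sigmaS_pos (s t : ℤ) (hs : s ≠ 0) (ht : 0 < t) : 0 < sigmaS s t := by
  have := alphaS_pos s
  have ht' : (0 : ℝ) < t := by exact_mod_cast ht
  have hs' : (s : ℝ) ≠ 0 := by exact_mod_cast hs
  unfold sigmaS; positivity

lemma exp_e_ge : (15 : ℝ) ≤ Real.exp (Real.exp 1) := by
  have he := Real.exp_one_gt_d9
  have h1 : (1 + 0.718 + 0.718 ^ 2 / 2 + 0.718 ^ 3 / 6 : ℝ) ≤ Real.exp 0.718 := by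
    have := Real.sum_le_exp_of_nonneg (x := 0.718) (by norm_num) 4
    refine le_trans (le_of_eq ?_) this
    simp [Finset.sum_range_succ, Nat.factorial]
  have h2 : Real.exp (1 + 1 + 0.718) ≤ Real.exp (Real.exp 1) := by
    apply Real.exp_le_exp.2; norm_num at he ⊢; linarith
  rw [Real.exp_add, Real.exp_add] at h2
  have h3 : (2.71828 * 2.71828 * (1 + 0.718 + 0.718 ^ 2 / 2 + 0.718 ^ 3 / 6) : ℝ)
     ≤ Real.exp 1 * Real.exp 1 * Real.exp 0.718 := by
    gcongr <;> · norm_num at he ⊢; linarith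
  norm_num at h3 h2
  linarith

lemma v_z_bounds (v : ℝ) (hv : 4 * Real.exp 1 ≤ v) :
    10.87 ≤ v ∧ 2.386 ≤ Real.log v ∧ Real.log v ≤ 0.22 * v ∧ 1.08 * v ≤ Real.exp (v / 4)
      ∧ 15 ≤ Real.exp (v / 4) := by
  have he := Real.exp_one_gt_d9
  have he2 := Real.exp_one_lt_d9
  have l1 := Real.log_two_gt_d9
  have l2 := Real.log_two_lt_d9
  have hv0 : (10.87 : ℝ) ≤ v := by linarith
  have h4 : Real.log (4 * Real.exp 1) = 2 * Real.log 2 + 1 := by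
    rw [Real.log_mul (by norm_num) (by positivity), Real.log_exp, show (4 : ℝ) = 2 ^ 2 by norm_num,
      Real.log_pow]; norm_num
  have hE := exp_e_ge
  refine ⟨hv0, ?_, ?_, ?_, ?_⟩
  · have := Real.log_le_log (by positivity) hv
    rw [h4] at this; linarith
  · have h1 := Real.log_le_sub_one_of_pos (x := v / (4 * Real.exp 1)) (by positivity)
    rw [Real.log_div (by positivity) (by positivity), h4] at h1
    have h2 : v / (4 * Real.exp 1) ≤ v / 10.87 := by
      apply div_le_div_of_nonneg_left (by linarith) (by norm_num) (by linarith)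
    have h3 : v / 10.87 ≤ 0.092 * v := by
      rw [div_le_iff₀ (by norm_num)]; linarith
    linarith
  · have h1 : Real.exp (v / 4) = Real.exp (Real.exp 1) * Real.exp (v / 4 - Real.exp 1) := by
      rw [← Real.exp_add]; congr 1; ring
    have h2 := Real.add_one_le_exp (v / 4 - Real.exp 1)
    have h3 : 15 * (v / 4 - Real.exp 1 + 1) ≤ Real.exp (Real.exp 1) * Real.exp (v / 4 - Real.exp 1) := by
      apply mul_le_mul hE h2 (by linarith) (by positivity)
    rw [h1]; linarith
  · exact hE.trans (Real.exp_le_exp.2 (by linarith))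

lemma rhoS_facts (s t : ℤ) (h0 : 0 < sigmaS s t) : 7 / 3 ≤ rhoS s t := by
  unfold rhoS
  split_ifs with h
  · rfl
  · push Not at h
    have := Real.log_neg h0 h
    linarith

lemma exp_v_eq (v : ℝ) : Real.exp v = Real.exp (v / 4) ^ 4 := by
  rw [← Real.exp_nat_mul]; congr 1; push_cast; ring

lemma bigL (v : ℝ) (hv : 4 * Real.exp 1 ≤ v) :
    v + 2 < 0.04 * (Real.log v / v) * Real.exp v := by
  obtain ⟨h1, h2, h3, h4, h5⟩ := v_z_bounds v hv
  rw [exp_v_eq]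
  set g := Real.exp (v / 4)
  have hv0 : 0 < v := by linarith
  rw [show 0.04 * (Real.log v / v) * g ^ 4 = (0.04 * Real.log v * g ^ 4) / v by ring, lt_div_iff₀ hv0]
  have a1 : 0.04 * 2.386 * g ^ 4 ≤ 0.04 * Real.log v * g ^ 4 := by gcongr
  have a2 : v ≤ g := by linarith
  have a3 : (v + 2) * v ≤ (g + 2) * g := by gcongr
  have a4 : 225 * g ^ 2 ≤ g ^ 4 := by
    have : 225 ≤ g ^ 2 := by nlinarith
    nlinarith
  nlinarith

lemma X_case1 (v σ : ℝ) (hv : 4 * Real.exp 1 ≤ v) (hσ : 1 ≤ σ) :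
    Real.exp v + v + 2 < (Real.exp v / v * (1 + 4 / 3 * (Real.log v / v))) *
      Real.log (σ * (Real.exp v / v * (1 + 4 / 3 * (Real.log v / v)))) := by
  obtain ⟨h1, h2, h3, h4, h5⟩ := v_z_bounds v hv
  have hv0 : 0 < v := by linarith
  have hb := bigL v hv
  set z := Real.log v with hz
  have he0 : 0 < z / v := by apply div_pos <;> linarith
  have he1 : z / v ≤ 0.22 := by rw [div_le_iff₀ hv0]; exact h3
  have hlog : v * (1 - z / v) ≤ Real.log (σ * (Real.exp v / v * (1 + 4 / 3 * (z / v)))) := by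
    have : v * (1 - z / v) = Real.log (Real.exp v / v) := by
      rw [Real.log_div (by positivity) (by positivity), Real.log_exp, ← hz]; field_simp
    rw [this]
    apply Real.log_le_log (by positivity)
    have hY : 0 < Real.exp v / v := by positivity
    have : 1 * (Real.exp v / v * 1) ≤ σ * (Real.exp v / v * (1 + 4 / 3 * (z / v))) := by
      gcongr; linarith
    linarith
  have hX : 0 ≤ Real.exp v / v * (1 + 4 / 3 * (z / v)) := by positivity
  have := mul_le_mul_of_nonneg_left hlog hX
  refine lt_of_lt_of_le ?_ this
  have e1 : Real.exp v / v * (1 + 4 / 3 * (z / v)) * (v * (1 - z / v))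
     = Real.exp v * ((1 + 4 / 3 * (z / v)) * (1 - z / v)) := by field_simp
  rw [e1]
  have hL := Real.exp_pos v
  set ε := z / v
  have : 1 + 0.04 * ε ≤ (1 + 4 / 3 * ε) * (1 - ε) := by nlinarith
  nlinarith

lemma X_case2 (v σ : ℝ) (hv : 4 * Real.exp 1 ≤ v) (hσ0 : 0 < σ) (hσ : σ < 1)
    (hσ2 : - Real.log σ ≤ v / 2) :
    Real.exp v + v + 2 < (Real.exp v / v * (1 + (4 - 2 * Real.log σ) * (Real.log v / v))) *
      Real.log (σ * (Real.exp v / v * (1 + (4 - 2 * Real.log σ) * (Real.log v / v)))) := by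
  obtain ⟨h1, h2, h3, h4, h5⟩ := v_z_bounds v hv
  have hv0 : 0 < v := by linarith
  have hb := bigL v hv
  have hl0 := Real.log_neg hσ0 hσ
  set z := Real.log v with hz
  obtain ⟨l, hl⟩ : ∃ l, l = - Real.log σ := ⟨_, rfl⟩
  have hl' : Real.log σ = - l := by linarith
  rw [hl'] at hl0 hσ2 ⊢
  have he0 : 0 < z / v := by apply div_pos <;> linarith
  have he1 : z / v ≤ 0.22 := by rw [div_le_iff₀ hv0]; exact h3
  have hlog : v * (1 - z / v - l / v) ≤ Real.log (σ * (Real.exp v / v * (1 + (4 - 2 * -l) * (z / v)))) := by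
    have : v * (1 - z / v - l / v) = Real.log (σ * (Real.exp v / v)) := by
      rw [Real.log_mul (by positivity) (by positivity), Real.log_div (by positivity) (by positivity), Real.log_exp, hl', ← hz]; field_simp; ring
    rw [this]
    apply Real.log_le_log (by positivity)
    have hY : 0 < Real.exp v / v := by positivity
    have : σ * (Real.exp v / v * 1) ≤ σ * (Real.exp v / v * (1 + (4 - 2 * -l) * (z / v))) := by
      gcongr
      have : 0 ≤ (4 - 2 * -l) * (z / v) := mul_nonneg (by linarith) he0.le
      linarith
    linarith
  have hk : 0 ≤ (4 - 2 * -l) * (z / v) := mul_nonneg (by linarith) he0.le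
  have hX : 0 ≤ Real.exp v / v * (1 + (4 - 2 * -l) * (z / v)) := by positivity
  have := mul_le_mul_of_nonneg_left hlog hX
  refine lt_of_lt_of_le ?_ this
  have e1 : Real.exp v / v * (1 + (4 - 2 * -l) * (z / v)) * (v * (1 - z / v - l / v))
     = Real.exp v * ((1 + (4 - 2 * -l) * (z / v)) * (1 - z / v - l / v)) := by field_simp
  rw [e1]
  have hL := Real.exp_pos v
  have hm : l / v ≤ 1 / 2 := by rw [div_le_iff₀ hv0]; linarith
  have hm0 : 0 ≤ l / v := by apply div_nonneg <;> linarith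
  have hlz : l / v * 2.386 ≤ l * (z / v) := by
    rw [show l * (z / v) = l / v * z by ring]; gcongr
  have : 1 + 0.04 * (z / v) ≤ (1 + (4 - 2 * -l) * (z / v)) * (1 - z / v - l / v) := by
    set ε := z / v
    set w := l / v
    have : 0 ≤ (4 * ε + 2 * (l * ε)) * ((1 - ε - w) - 0.28) := by
      apply mul_nonneg <;> nlinarith
    nlinarith
  nlinarith

lemma X_case3 (v σ : ℝ) (hv : 4 * Real.exp 1 ≤ v) (hσ : 2 ≤ σ * Real.exp 1) :
    Real.exp v + v + 2 < (1.5 * (Real.exp v / v)) * Real.log (σ * (1.5 * (Real.exp v / v))) := by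
  obtain ⟨h1, h2, h3, h4, h5⟩ := v_z_bounds v hv
  have hv0 : 0 < v := by linarith
  have hb := bigL v hv
  have he2 := Real.exp_one_lt_d9
  set z := Real.log v with hz
  have he0 : 0 < z / v := by apply div_pos <;> linarith
  have he1 : z / v ≤ 0.22 := by rw [div_le_iff₀ hv0]; exact h3
  have hs : 1 ≤ σ * 1.5 := by
    have hσ0 : 0 < σ := by
      by_contra hcon
      push Not at hcon
      nlinarith [Real.exp_pos 1]
    nlinarith
  have hlog : v * (1 - z / v) ≤ Real.log (σ * (1.5 * (Real.exp v / v))) := by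
    have : v * (1 - z / v) = Real.log (Real.exp v / v) := by
      rw [Real.log_div (by positivity) (by positivity), Real.log_exp, ← hz]; field_simp
    rw [this]
    apply Real.log_le_log (by positivity)
    have hY : 0 < Real.exp v / v := by positivity
    nlinarith
  have hX : 0 ≤ 1.5 * (Real.exp v / v) := by positivity
  have := mul_le_mul_of_nonneg_left hlog hX
  refine lt_of_lt_of_le ?_ this
  have e1 : 1.5 * (Real.exp v / v) * (v * (1 - z / v))
     = Real.exp v * (1.5 * (1 - z / v)) := by field_simp
  rw [e1]
  have hL := Real.exp_pos v
  set ε := z / v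
  have : 1 + 0.04 * ε ≤ 1.5 * (1 - ε) := by nlinarith
  nlinarith

lemma logN2_facts (s t : ℤ) : logN1 s t ≤ logN2 s t ∧ Real.exp (4 * Real.exp 1) ≤ logN2 s t ∧
    (sigmaS s t) ^ (-2 : ℤ) ≤ logN2 s t ∧ (betaS s : ℝ) ^ 2 ≤ logN2 s t ∧
    ((rhoS s t * (2 * (betaS s : ℝ) + 1) / (2 * Real.log (|(s : ℝ)| / alphaS s)))
        ^ ((4 : ℝ) / 3)) ≤ logN2 s t := by
  unfold logN2
  refine ⟨?_, ?_, ?_, ?_, ?_⟩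
  · exact le_max_of_le_left (le_max_of_le_left (le_max_of_le_left (le_max_left _ _)))
  · exact le_max_of_le_left (le_max_of_le_left (le_max_of_le_left (le_max_right _ _)))
  · exact le_max_of_le_left (le_max_of_le_left (le_max_right _ _))
  · exact le_max_of_le_left (le_max_right _ _)
  · exact le_max_right _ _

lemma G_bound (s t : ℤ) (hs : s ≠ 0) (ht : 0 < t) (L : ℝ) (hL1 : logN1 s t ≤ L)
    (hL3 : 9 ≤ L) (hb : (betaS s : ℝ) ^ 2 ≤ L) :
    |Real.exp ((s : ℝ) / (t : ℝ)) - 1| * gammaS s / sigmaS s t ^ betaS s ≤ 2 * L := by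
  have hσ := sigmaS_pos s t hs ht
  set σ := sigmaS s t with hσd
  set β : ℝ := (betaS s : ℝ) with hβ
  have hβ0 : 0 ≤ β := by positivity
  set G := |Real.exp ((s : ℝ) / (t : ℝ)) - 1| * gammaS s / σ ^ betaS s with hG
  have hG0 : 0 ≤ G := by positivity
  have he := Real.exp_one_gt_d9
  have e1 : G - 1 / 2 ≤ etaS s t := by
    refine le_trans ?_ (le_max_left _ _)
    have h2 : Real.sqrt 2 ≤ Real.sqrt (Real.exp 1) := Real.sqrt_le_sqrt (by linarith)
    have h20 : 0 < Real.sqrt 2 := by positivity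
    have : Real.sqrt (Real.exp 1) * |Real.exp ((s : ℝ) / (t : ℝ)) - 1| * (gammaS s : ℝ)
        / (Real.sqrt 2 * sigmaS s t ^ (betaS s)) = Real.sqrt (Real.exp 1) / Real.sqrt 2 * G := by
      rw [hG, hσd]; field_simp
    rw [this]
    have h3 : 1 ≤ Real.sqrt (Real.exp 1) / Real.sqrt 2 := by rw [le_div_iff₀ h20]; linarith
    nlinarith
  have e2 : Real.exp 1 / σ + β ≤ etaS s t := le_max_right _ _
  have e3 : (etaS s t - β) * Real.log (σ * (etaS s t - β)) ≤ L := le_trans (le_max_left _ _) hL1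
  set ξ := etaS s t - β with hξ
  have hξ1 : Real.exp 1 / σ ≤ ξ := by linarith
  have hξ2 : Real.exp 1 ≤ σ * ξ := by rw [div_le_iff₀ hσ] at hξ1; linarith
  have hξ0 : 0 < ξ := lt_of_lt_of_le (by positivity) hξ1
  have h1 : 1 ≤ Real.log (σ * ξ) := by
    rw [Real.le_log_iff_exp_le (by positivity)]; exact hξ2
  have hξL : ξ ≤ L := by nlinarith
  have : β ≤ L / 3 := by nlinarith [sq_nonneg (β - 3)]
  nlinarith

lemma m_bound (s t : ℤ) (hs : s ≠ 0) (ht : 0 < t) (L X : ℝ) (hL : 1 ≤ L) (hX : 0 < X)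
    (hG : |Real.exp ((s : ℝ) / (t : ℝ)) - 1| * gammaS s / sigmaS s t ^ betaS s ≤ 2 * L)
    (hbig : L + Real.log L + 2 < X * Real.log (sigmaS s t * X)) (m : ℕ) (hm1 : 1 ≤ m)
    (hm : (padD s m : ℝ) ≤ 2 * (Real.exp L * padA s t m)) : (m : ℝ) ≤ X + betaS s := by
  by_contra hcon
  push Not at hcon
  have hσ := sigmaS_pos s t hs ht
  set σ := sigmaS s t with hσd
  have hLL := Real.log_nonneg hL
  have hm0 : (0 : ℝ) < m := by exact_mod_cast hm1
  have hlog0 : 0 < Real.log (σ * X) := by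
    by_contra h
    push Not at h
    nlinarith
  obtain ⟨k, hk⟩ : ∃ k, m = k + betaS s := by
    have : (betaS s : ℝ) ≤ m := by linarith
    have : betaS s ≤ m := by exact_mod_cast this
    exact ⟨m - betaS s, by omega⟩
  have hkX : X < k := by
    have : (m : ℝ) = k + betaS s := by exact_mod_cast hk
    linarith
  have hkm : (k : ℝ) ≤ m := by exact_mod_cast (by omega : k ≤ m)
  have hpow : 4 * L * Real.exp L < (σ * m) ^ k := by
    have h1 : (σ * m) ^ k = Real.exp (k * Real.log (σ * m)) := by
      rw [← Real.log_pow, Real.exp_log (by positivity)]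
    have h2 : X * Real.log (σ * X) ≤ k * Real.log (σ * m) := by
      apply mul_le_mul hkX.le _ hlog0.le (by positivity)
      apply Real.log_le_log (by positivity)
      gcongr; linarith
    have h3 : Real.exp (L + Real.log L + 2) < Real.exp (k * Real.log (σ * m)) :=
      Real.exp_lt_exp.2 (by linarith)
    rw [h1]
    refine lt_of_le_of_lt ?_ h3
    rw [Real.exp_add, Real.exp_add, Real.exp_log (by linarith)]
    have h4 : 4 ≤ Real.exp 2 := by
      have he := Real.exp_one_gt_d9
      have : Real.exp 2 = Real.exp 1 * Real.exp 1 := by rw [← Real.exp_add]; norm_num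
      nlinarith
    have : 0 < Real.exp L * L := by positivity
    nlinarith
  have hα := alphaS_pos s
  have hs' : (s : ℝ) ≠ 0 := by exact_mod_cast hs
  have ht' : (0 : ℝ) < t := by exact_mod_cast ht
  set F := |Real.exp ((s : ℝ) / (t : ℝ)) - 1| with hF
  have hF0 : 0 ≤ F := abs_nonneg _
  have hA := padA_le s t ht m
  rw [← hF] at hA
  have hr : (s : ℝ) ^ 2 / (4 * t) = alphaS s / (Real.exp 1 * σ) := by
    rw [hσd]; unfold sigmaS; field_simp
  have hfac : (m : ℝ) ^ m ≤ Real.exp 1 ^ m * m.factorial := by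
    have := Real.pow_div_factorial_le_exp (m : ℝ) hm0.le m
    rw [div_le_iff₀ (by positivity)] at this
    rw [← Real.exp_nat_mul, mul_one]; exact this
  have hA2 : padA s t m * (σ * m) ^ m ≤ alphaS s ^ m * F := by
    calc padA s t m * (σ * m) ^ m ≤ ((s : ℝ) ^ 2 / (4 * t)) ^ m / m.factorial * F * (σ * m) ^ m := by gcongr
      _ = alphaS s ^ m * F * (m ^ m / (Real.exp 1 ^ m * m.factorial)) := by
        rw [hr, div_pow, mul_pow, mul_pow]; field_simp
      _ ≤ alphaS s ^ m * F * 1 := by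
        gcongr
        rw [div_le_one (by positivity)]; exact hfac
      _ = _ := by ring
  have hD := padD_lower s m hm1
  have hA3 : padA s t m * (σ * m) ^ m ≤ padD s m * (gammaS s * m ^ (betaS s)) * F :=
    hA2.trans (by gcongr)
  have hsplit : (σ * m) ^ m = (σ * m) ^ k * (σ ^ betaS s * (m : ℝ) ^ betaS s) := by
    rw [← mul_pow, ← pow_add, ← hk]
  have hA4 : padA s t m * (σ * m) ^ k ≤ padD s m * (F * gammaS s / σ ^ betaS s) := by
    have hp : 0 < σ ^ betaS s * (m : ℝ) ^ betaS s := by positivity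
    refine le_of_mul_le_mul_right ?_ hp
    calc _ = padA s t m * (σ * m) ^ m := by rw [hsplit]; ring
      _ ≤ _ := hA3
      _ = _ := by field_simp
  have hDp : (0 : ℝ) < padD s m := by exact_mod_cast padD_pos s m
  have hA5 : padA s t m * (σ * m) ^ k ≤ padD s m * (2 * L) := hA4.trans (by gcongr)
  have hAp := padA_pos s t hs ht m
  have hEL := Real.exp_pos L
  have f1 : padA s t m * (4 * L * Real.exp L) < padA s t m * (σ * m) ^ k := by gcongr
  have f2 : padA s t m * (4 * L * Real.exp L) < padD s m * (2 * L) := lt_of_lt_of_le f1 hA5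
  have f3 : (2 * L) * (2 * (Real.exp L * padA s t m)) < (2 * L) * padD s m := by nlinarith
  have := lt_of_mul_lt_mul_left f3 (by linarith)
  linarith

lemma m_one (s t : ℤ) (hs : s ≠ 0) (ht : 0 < t) (L : ℝ) (hL1 : logN1 s t ≤ L) :
    (padD s 1 : ℝ) ≤ 2 * (Real.exp L * padA s t 1) := by
  have h := (le_max_right _ _).trans hL1
  have hA := padA_pos s t hs ht 1
  have e : |4 * (s : ℝ) + 2 * ((s : ℝ) - 2 * (t : ℝ)) * (Real.exp ((s : ℝ) / (t : ℝ)) - 1)| = 2 * padA s t 1 := by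
    have h3 : 4 * (s : ℝ) + 2 * ((s : ℝ) - 2 * (t : ℝ)) * (Real.exp ((s : ℝ) / (t : ℝ)) - 1)
        = 2 * padR s t 1 := by rw [padR_one s t ht]; ring
    rw [h3, abs_mul, abs_of_pos (by norm_num : (0 : ℝ) < 2)]; rfl
  rw [e] at h
  rw [padD_one s hs]
  have hg : (0 : ℝ) < (Int.gcd 2 s : ℝ) := by
    exact_mod_cast Int.gcd_pos_of_ne_zero_left _ (by norm_num)
  rw [Real.log_le_iff_le_exp (by positivity), div_le_iff₀ (by positivity)] at h
  linarith

lemma m_exists (s t : ℤ) (hs : s ≠ 0) (ht : 0 < t) (L X : ℝ) (hL : 9 ≤ L) (hX : 0 < X)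
    (hL1 : logN1 s t ≤ L) (hb : (betaS s : ℝ) ^ 2 ≤ L)
    (hbig : L + Real.log L + 2 < X * Real.log (sigmaS s t * X)) :
    ∃ m : ℕ, 1 ≤ m ∧ (m : ℝ) ≤ X + betaS s ∧ (padD s m : ℝ) ≤ 2 * (Real.exp L * padA s t m) ∧
      ∀ n, m < n → 2 * (Real.exp L * padA s t n) ≤ padD s n := by
  classical
  have hG := G_bound s t hs ht L hL1 hL hb
  have hB := m_bound s t hs ht L X (by linarith) hX hG hbig
  have h1 := m_one s t hs ht L hL1
  let P : ℕ → Prop := fun n => 1 ≤ n ∧ (padD s n : ℝ) ≤ 2 * (Real.exp L * padA s t n)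
  have hPb : ∀ n, P n → n ≤ ⌊X + betaS s⌋₊ := fun n hn => Nat.le_floor (hB n hn.1 hn.2)
  have hP1 : P 1 := ⟨le_rfl, h1⟩
  have hPm : P (Nat.findGreatest P ⌊X + betaS s⌋₊) := Nat.findGreatest_spec (hPb 1 hP1) hP1
  refine ⟨Nat.findGreatest P ⌊X + betaS s⌋₊, hPm.1, hB _ hPm.1 hPm.2, hPm.2, ?_⟩
  intro n hn
  by_contra hcon
  push Not at hcon
  have hPn : P n := ⟨by omega, hcon.le⟩
  have := Nat.le_findGreatest (hPb n hPn) hPn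
  omega

lemma K_bound (s t : ℤ) (ht : 0 < t) (m : ℕ) (hm : 1 ≤ m) (N W : ℝ)
    (hN : 6 * ((m : ℝ) + 1) ≤ N)
    (hW : 4 * ((m : ℝ) + 1) * t + 6 * t + (s : ℝ) ^ 2 ≤ W) :
    padK s t m * (1 + 1 / (2 * N)) + 1 / (2 * N) < (1 - 1 / (2 * N)) * W := by
  have ht' : (1 : ℝ) ≤ t := by exact_mod_cast ht
  have hm' : (1 : ℝ) ≤ m := by exact_mod_cast hm
  set n : ℝ := (m : ℝ) + 1 with hn
  have hn2 : 2 ≤ n := by linarith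
  have hN0 : 0 < N := by linarith
  have hS : 0 ≤ (s : ℝ) ^ 2 := sq_nonneg _
  set S := (s : ℝ) ^ 2 with hSd
  set h := 1 / (2 * N) with hh
  have hh0 : 0 < h := by positivity
  have hh1 : h * n ≤ 1 / 12 := by
    rw [hh, div_mul_eq_mul_div, div_le_iff₀ (by positivity)]; linarith
  have hh2 : h ≤ 1 / 24 := by nlinarith
  have hK : padK s t m ≤ (4 * n + 2) * t + S / 6 := by
    unfold padK
    have : (s : ℝ) ^ 2 / ((4 * m + 2) * t) ≤ S / 6 := by
      apply div_le_div_of_nonneg_left hS (by norm_num)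
      nlinarith
    rw [hn]; linarith
  have h1 : padK s t m * (1 + h) ≤ ((4 * n + 2) * t + S / 6) * (1 + h) := by gcongr
  have h2 : (1 - h) * (4 * n * t + 6 * t + S) ≤ (1 - h) * W := by
    apply mul_le_mul_of_nonneg_left hW; linarith
  have a1 : h * n * t ≤ 1 / 12 * t := by gcongr
  have a2 : h * t ≤ 1 / 24 * t := by gcongr
  have a3 : h * S ≤ 1 / 24 * S := by gcongr
  nlinarith

lemma T_bound (s : ℤ) (m : ℕ) (hm : 1 ≤ m) :
    |(s : ℝ)| ^ (2 * m + 1) / (padD s m * padD s (m + 1) : ℝ)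
      ≤ (gammaS s : ℝ) ^ 2 * ((m : ℝ) + 1) ^ (2 * betaS s) * (|(s : ℝ)| / alphaS s) ^ (2 * m + 1) := by
  have hα := alphaS_pos s
  have h1 := padD_lower s m hm
  have h2 := padD_lower s (m + 1) (by omega)
  have d1 : (0 : ℝ) < padD s m := by exact_mod_cast padD_pos s m
  have d2 : (0 : ℝ) < padD s (m + 1) := by exact_mod_cast padD_pos s (m + 1)
  push_cast at h2
  have h3 : alphaS s ^ m ≤ padD s m * (gammaS s * ((m : ℝ) + 1) ^ betaS s) := by
    refine h1.trans ?_
    gcongr; linarith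
  have h4 : alphaS s ^ (2 * m + 1) ≤ (padD s m * padD s (m + 1) : ℝ) *
      ((gammaS s : ℝ) ^ 2 * ((m : ℝ) + 1) ^ (2 * betaS s)) := by
    calc alphaS s ^ (2 * m + 1) = alphaS s ^ m * alphaS s ^ (m + 1) := by ring
      _ ≤ (padD s m * (gammaS s * ((m : ℝ) + 1) ^ betaS s)) * (padD s (m + 1) * (gammaS s * ((m : ℝ) + 1) ^ betaS s)) := by
        gcongr
      _ = _ := by ring
  rw [div_pow, div_le_iff₀ (by positivity), mul_div_assoc', div_mul_eq_mul_div, le_div_iff₀ (by positivity)]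
  calc _ ≤ |(s : ℝ)| ^ (2 * m + 1) * ((padD s m * padD s (m + 1) : ℝ) *
      ((gammaS s : ℝ) ^ 2 * ((m : ℝ) + 1) ^ (2 * betaS s))) := by gcongr
    _ = _ := by ring

lemma finish_core (s t : ℤ) (hs : s ≠ 0) (ht : 0 < t) (M N : ℤ) (hN : 0 < N) (m : ℕ)
    (c ν Y d Z : ℝ) (hc : 1 ≤ c) (hm : 1 ≤ m)
    (h0 : (padD s m : ℝ) ≤ 2 * (N * padA s t m))
    (h1 : 2 * (N * padA s t (m + 1)) ≤ padD s (m + 1))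
    (h2 : 2 * (N * padA s t (m + 2)) ≤ padD s (m + 2))
    (h2' : c * (N * padA s t (m + 2)) ≤ (c - 1) * padD s (m + 2))
    (hN6 : 6 * ((m : ℝ) + 1) ≤ N) (hY : 0 < Y) (hd : 0 < d) (hdY : 1 ≤ d * Y)
    (hν : 1 ≤ ν) (hn : (m : ℝ) + 1 ≤ ν * Y)
    (hfin : c * ν ^ (2 * betaS s + 1) * (|(s : ℝ)| / alphaS s) ^ (2 * m + 1)
      ≤ 2 * (|(s : ℝ)| / alphaS s) ^ (2 * betaS s + 1) * Z) :
    1 < |Real.exp ((s : ℝ) / t) - M / N| *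
      (8 * (gammaS s : ℝ) ^ 2 * |(s : ℝ)| ^ (2 * betaS s + 1)
        * (4 * (t : ℝ) + d * (6 * (t : ℝ) + (s : ℝ) ^ 2)) / (alphaS s) ^ (2 * betaS s + 1))
      * ((N : ℝ) ^ 2 * Z) * Y ^ (2 * betaS s + 1) := by
  have core := pad_core s t hs ht M N hN m c hc h0 h1 h2 h2'
  have ht' : (0 : ℝ) < t := by exact_mod_cast ht
  have hN0 : (0 : ℝ) < N := by exact_mod_cast hN
  have hα := alphaS_pos s
  have hs0 : 0 < |(s : ℝ)| := by simpa using hs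
  have d1 : (0 : ℝ) < padD s m := by exact_mod_cast padD_pos s m
  have d2 : (0 : ℝ) < padD s (m + 1) := by exact_mod_cast padD_pos s (m + 1)
  set δ := |Real.exp ((s : ℝ) / t) - M / N| with hδ
  have hδ0 : 0 ≤ δ := abs_nonneg _
  set Q := 4 * (t : ℝ) + d * (6 * (t : ℝ) + (s : ℝ) ^ 2) with hQ
  have hQ0 : 0 < Q := by positivity
  set W := 4 * ((m : ℝ) + 1) * t + (d * Y) * (6 * t + (s : ℝ) ^ 2) with hW
  have hW0 : 0 < W := by positivity
  have hWge : 4 * ((m : ℝ) + 1) * t + 6 * t + (s : ℝ) ^ 2 ≤ W := by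
    have : 1 * (6 * (t : ℝ) + (s : ℝ) ^ 2) ≤ (d * Y) * (6 * t + (s : ℝ) ^ 2) := by gcongr
    linarith
  have hWle : W ≤ ν * Y * Q := by
    have a1 : 4 * ((m : ℝ) + 1) * t ≤ 4 * (ν * Y) * t := by gcongr
    have a2 : 1 * (d * Y * (6 * t + (s : ℝ) ^ 2)) ≤ ν * (d * Y * (6 * t + (s : ℝ) ^ 2)) := by gcongr
    rw [hW, hQ]; linarith
  have hK := K_bound s t ht m hm N W hN6 hWge
  have hT := T_bound s m hm
  set T := |(s : ℝ)| ^ (2 * m + 1) / (padD s m * padD s (m + 1) : ℝ) with hTd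
  have hT0 : 0 < T := by positivity
  have hm' : (1 : ℝ) ≤ m := by exact_mod_cast hm
  have hh : 0 < 1 - 1 / (2 * (N : ℝ)) := by
    have : 1 / (2 * (N : ℝ)) < 1 := by
      rw [div_lt_one (by positivity)]; linarith
    linarith
  set h := 1 / (2 * (N : ℝ))
  have hδpos : 0 < δ := by
    rcases hδ0.eq_or_lt with h | h
    · rw [← h] at core; simp at core; linarith
    · exact h
  have s1 : 1 - h < c * δ * (N : ℝ) ^ 2 * ((1 - h) * W) * (4 * T) := by
    refine lt_of_le_of_lt core ?_
    gcongr
  have s2 : 1 < c * δ * (N : ℝ) ^ 2 * W * (4 * T) := by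
    have : (1 - h) * 1 < (1 - h) * (c * δ * (N : ℝ) ^ 2 * W * (4 * T)) := by linarith
    exact lt_of_mul_lt_mul_left this hh.le
  refine lt_of_lt_of_le s2 ?_
  set r := |(s : ℝ)| / alphaS s with hr
  have hr0 : 0 < r := by positivity
  calc c * δ * (N : ℝ) ^ 2 * W * (4 * T)
      ≤ c * δ * (N : ℝ) ^ 2 * (ν * Y * Q) *
        (4 * ((gammaS s : ℝ) ^ 2 * (ν * Y) ^ (2 * betaS s) * r ^ (2 * m + 1))) := by
        gcongr
        refine hT.trans ?_
        gcongr
    _ = 4 * δ * (N : ℝ) ^ 2 * Q * (gammaS s : ℝ) ^ 2 * Y ^ (2 * betaS s + 1) *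
        (c * ν ^ (2 * betaS s + 1) * r ^ (2 * m + 1)) := by
        rw [mul_pow]; ring
    _ ≤ 4 * δ * (N : ℝ) ^ 2 * Q * (gammaS s : ℝ) ^ 2 * Y ^ (2 * betaS s + 1) *
        (2 * r ^ (2 * betaS s + 1) * Z) := by gcongr
    _ = _ := by rw [hr, div_pow]; ring

lemma dS_facts (s t : ℤ) (hs : s ≠ 0) (ht : 0 < t) (v : ℝ) (hv : 4 * Real.exp 1 ≤ v)
    (hL : logN2 s t ≤ Real.exp v) : 0 < dS s t ∧ 1 ≤ dS s t * (Real.exp v / v) := by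
  obtain ⟨k1, k2, k3, k4, k5⟩ := logN2_facts s t
  obtain ⟨h1, h2, h3, h4, h5⟩ := v_z_bounds v hv
  have hσ := sigmaS_pos s t hs ht
  have hv0 : 0 < v := by linarith
  have hL0 : 0 < logN2 s t := lt_of_lt_of_le (Real.exp_pos _) k2
  unfold dS
  set D := (logN2 s t) ^ ((1 : ℝ) / 4) / sigmaS s t + (betaS s : ℝ) with hD
  have hD0 : 0 < D := by positivity
  refine ⟨by positivity, ?_⟩
  have e4 := exp_v_eq v
  set g := Real.exp (v / 4) with hg
  have hg0 : 0 < g := Real.exp_pos _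
  have a1 : (logN2 s t) ^ ((1 : ℝ) / 4) ≤ g := by
    calc (logN2 s t) ^ ((1 : ℝ) / 4) ≤ (Real.exp v) ^ ((1 : ℝ) / 4) := by gcongr
      _ = g := by rw [← Real.exp_mul, hg]; congr 1; ring
  have a2 : (sigmaS s t)⁻¹ ≤ g ^ 2 := by
    have : ((sigmaS s t)⁻¹) ^ 2 ≤ (g ^ 2) ^ 2 := by
      calc ((sigmaS s t)⁻¹) ^ 2 = (sigmaS s t) ^ (-2 : ℤ) := by
            rw [inv_pow, zpow_neg]; norm_cast
        _ ≤ g ^ 4 := by linarith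
        _ = _ := by ring
    exact le_of_sq_le_sq this (by positivity)
  have a3 : (betaS s : ℝ) ≤ g ^ 2 := by
    have : ((betaS s : ℝ)) ^ 2 ≤ (g ^ 2) ^ 2 := by
      calc _ ≤ g ^ 4 := by linarith
        _ = _ := by ring
    exact le_of_sq_le_sq this (by positivity)
  have a4 : D ≤ g * g ^ 2 + g ^ 2 := by
    rw [hD, div_eq_mul_inv]; gcongr
  rw [inv_mul_eq_div, le_div_iff₀ hD0, one_mul, e4, le_div_iff₀ hv0]
  calc D * v ≤ (g * g ^ 2 + g ^ 2) * v := by gcongr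
    _ = g ^ 2 * ((g + 1) * v) := by ring
    _ ≤ g ^ 2 * g ^ 2 := by
      gcongr
      nlinarith
    _ = g ^ 4 := by ring

lemma c2S_ge (s t : ℤ) (ht : 0 < t) (hd : 0 < dS s t) :
    8 * (gammaS s : ℝ) ^ 2 * |(s : ℝ)| ^ (2 * betaS s + 1)
        * (4 * (t : ℝ) + dS s t * (6 * (t : ℝ) + (s : ℝ) ^ 2)) / (alphaS s) ^ (2 * betaS s + 1)
      ≤ c2S s t := by
  have ht' : (0 : ℝ) < t := by exact_mod_cast ht
  have hα := alphaS_pos s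
  unfold c2S
  have hz : 0 ≤ (s : ℝ) ^ (2 * ((betaS s : ℤ) - 1)) := by
    rw [zpow_mul]; positivity
  refine le_trans ?_ (le_add_of_nonneg_right (by positivity))
  have h1 : 1 ≤ (1 + dS s t) ^ betaS s := one_le_pow₀ (by linarith)
  calc _ = 8 * (gammaS s : ℝ) ^ 2 * |(s : ℝ)| ^ (2 * betaS s + 1) * 1
        * (4 * (t : ℝ) + dS s t * (6 * (t : ℝ) + (s : ℝ) ^ 2)) / (alphaS s) ^ (2 * betaS s + 1) := by ring
    _ ≤ _ := by gcongr

set_option maxHeartbeats 1600000 in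
lemma main_core (s t : ℤ) (hs : s ≠ 0) (ht : 0 < t) (M N : ℤ) (hN : 0 < N) (v : ℝ)
    (hv : 4 * Real.exp 1 ≤ v) (hNv : (N : ℝ) = Real.exp (Real.exp v))
    (hL : logN2 s t ≤ Real.exp v) :
    1 < |Real.exp ((s : ℝ) / t) - M / N| *
      (8 * (gammaS s : ℝ) ^ 2 * |(s : ℝ)| ^ (2 * betaS s + 1)
        * (4 * (t : ℝ) + dS s t * (6 * (t : ℝ) + (s : ℝ) ^ 2)) / (alphaS s) ^ (2 * betaS s + 1))
      * ((N : ℝ) ^ 2 * Real.exp (2 * Real.log (|(s : ℝ)| / alphaS s) * (Real.exp v / v)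
          * (1 + rhoS s t * (Real.log v / v)))) * (Real.exp v / v) ^ (2 * betaS s + 1) := by
  obtain ⟨k1, k2, k3, k4, k5⟩ := logN2_facts s t
  obtain ⟨b1, b2, b3, b4, b5⟩ := v_z_bounds v hv
  obtain ⟨hd, hdY⟩ := dS_facts s t hs ht v hv hL
  have hσ := sigmaS_pos s t hs ht
  have hα := alphaS_pos s
  have hs0 : 0 < |(s : ℝ)| := by simpa using hs
  have hv0 : 0 < v := by linarith
  have e4 := exp_v_eq v
  have hρ := rhoS_facts s t hσ
  set z := Real.log v with hz
  have hε0 : 0 < z / v := by apply div_pos <;> linarith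
  have hε1 : z / v ≤ 0.22 := by rw [div_le_iff₀ hv0]; exact b3
  set L := Real.exp v with hLd
  have hL0 : 0 < L := Real.exp_pos v
  set g := Real.exp (v / 4) with hg
  have hg4 : 50000 ≤ L := by
    rw [e4]
    have : (15 : ℝ) ^ 4 ≤ g ^ 4 := by gcongr
    norm_num at this; linarith
  have hlogL : Real.log L = v := Real.log_exp v
  set Y := L / v with hYd
  have hY0 : 0 < Y := by positivity
  have hYg : g ^ 3 ≤ Y := by
    rw [hYd, le_div_iff₀ hv0, e4]
    calc g ^ 3 * v ≤ g ^ 3 * g := by gcongr; linarith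
      _ = g ^ 4 := by ring
  have hβg : (betaS s : ℝ) ≤ g ^ 2 := by
    have : ((betaS s : ℝ)) ^ 2 ≤ (g ^ 2) ^ 2 := by
      calc _ ≤ g ^ 4 := by linarith
        _ = _ := by ring
    exact le_of_sq_le_sq this (by positivity)
  have hβY : (betaS s : ℝ) + 1 ≤ Y * (z / v) := by
    have : Y * (z / v) = (z * g ^ 4) / v ^ 2 := by rw [hYd, e4]; field_simp
    rw [this, le_div_iff₀ (by positivity)]
    have a1 : v ^ 2 ≤ g ^ 2 := by gcongr; linarith
    have a2 : 225 ≤ g ^ 2 := by nlinarith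
    calc ((betaS s : ℝ) + 1) * v ^ 2 ≤ (g ^ 2 + 1) * g ^ 2 := by gcongr
      _ ≤ 2 * g ^ 4 := by nlinarith
      _ ≤ z * g ^ 4 := by gcongr; linarith
  have hN6L : 6 * L ≤ N := by
    rw [hNv]
    have := Real.quadratic_le_exp_of_nonneg hL0.le
    nlinarith
  by_cases h3 : s.natAbs < 3
  · obtain ⟨ha, hb⟩ := small_s s hs h3
    have hσ2 := small_sigmaS s t hs ht h3
    have hX := X_case3 v (sigmaS s t) hv hσ2
    obtain ⟨m, hm1, hmX, hm0, hmn⟩ := m_exists s t hs ht L (1.5 * Y) (by linarith) (by positivity)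
      (k1.trans hL) (k4.trans hL) (by rw [hlogL]; exact hX)
    rw [← hNv] at hm0 hmn
    have hm1' : (1 : ℝ) ≤ m := by exact_mod_cast hm1
    have hbr : (betaS s : ℝ) = 0 := by rw [hb]; norm_num
    have hY10 : 10 ≤ Y := by
      have : (15 : ℝ) ^ 3 ≤ g ^ 3 := by gcongr
      norm_num at this; linarith
    have hn : (m : ℝ) + 1 ≤ 1.6 * Y := by linarith
    have hYL : 1.6 * Y ≤ L := by
      calc 1.6 * Y ≤ v * Y := by gcongr; linarith
        _ = L := by rw [hYd]; field_simp
    have hsS : (s : ℝ) ^ 2 ≤ 4 := by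
      have habs : |(s : ℝ)| = (s.natAbs : ℝ) := by rw [Nat.cast_natAbs]; simp
      have : |(s : ℝ)| ≤ 2 := by rw [habs]; exact_mod_cast (by omega : s.natAbs ≤ 2)
      rw [← sq_abs]
      calc |(s : ℝ)| ^ 2 ≤ 2 ^ 2 := by gcongr
        _ = 4 := by norm_num
    have ht' : (1 : ℝ) ≤ t := by exact_mod_cast ht
    have hN0 : (0 : ℝ) < N := by exact_mod_cast hN
    have q1 := hmn (m + 1) (by omega)
    have q2 := hmn (m + 2) (by omega)
    have hr1 : |(s : ℝ)| / alphaS s = 1 := by rw [ha]; field_simp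
    refine finish_core s t hs ht M N hN m (6 / 5) 1.6 Y (dS s t) _ (by norm_num) hm1 hm0 q1 q2 ?_
      (by linarith) hY0 hd hdY (by norm_num) hn ?_
    · have hA := padA_succ s t ht (m + 1)
      have hc : (s : ℝ) ^ 2 / (4 * t * (((m + 1 : ℕ) : ℝ) + 1)) ≤ 1 / 3 := by
        push_cast
        rw [div_le_iff₀ (by positivity)]
        nlinarith
      have hAp := padA_pos s t hs ht (m + 1)
      have hA' : padA s t (m + 2) ≤ 1 / 3 * padA s t (m + 1) := hA.trans (by gcongr)
      have hD : (padD s (m + 1) : ℝ) ≤ padD s (m + 2) := by exact_mod_cast padD_mono s (m + 1)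
      have : (N : ℝ) * padA s t (m + 2) ≤ N * (1 / 3 * padA s t (m + 1)) := by gcongr
      linarith
    · rw [hr1, hb]; norm_num
  · push Not at h3
    have hlt := alphaS_lt s h3
    have hr1 : 1 < |(s : ℝ)| / alphaS s := by rw [lt_div_iff₀ hα]; linarith
    set r := |(s : ℝ)| / alphaS s with hr
    set ℓ := Real.log r with hℓ
    have hℓ0 : 0 < ℓ := Real.log_pos hr1
    have hrexp : r = Real.exp ℓ := by rw [hℓ, Real.exp_log (by linarith)]
    have hlogσ : - Real.log (sigmaS s t) ≤ v / 2 := by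
      have : Real.log ((sigmaS s t) ^ (-2 : ℤ)) ≤ v := by
        rw [Real.log_le_iff_le_exp (by positivity)]; linarith
      rw [Real.log_zpow] at this
      push_cast at this
      linarith
    set ρ := rhoS s t with hρd
    have hρv : ρ ≤ 5 + v := by
      rw [hρd]; unfold rhoS
      split_ifs <;> linarith
    have hX : L + v + 2 < (Y * (1 + (ρ - 1) * (z / v))) *
        Real.log (sigmaS s t * (Y * (1 + (ρ - 1) * (z / v)))) := by
      by_cases h1 : sigmaS s t ≥ 1
      · have : ρ - 1 = 4 / 3 := by rw [hρd]; unfold rhoS; rw [if_pos h1]; norm_num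
        rw [this]; exact X_case1 v _ hv h1
      · have : ρ - 1 = 4 - 2 * Real.log (sigmaS s t) := by
          rw [hρd]; unfold rhoS; rw [if_neg h1]; ring
        rw [this]; exact X_case2 v _ hv hσ (by linarith) hlogσ
    have hX0 : 0 < Y * (1 + (ρ - 1) * (z / v)) := by
      have : 0 < (ρ - 1) * (z / v) := mul_pos (by linarith) hε0
      positivity
    obtain ⟨m, hm1, hmX, hm0, hmn⟩ := m_exists s t hs ht L _ (by linarith) hX0
      (k1.trans hL) (k4.trans hL) (by rw [hlogL]; exact hX)
    rw [← hNv] at hm0 hmn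
    have q1 := hmn (m + 1) (by omega)
    have q2 := hmn (m + 2) (by omega)
    set ε := z / v with hεd
    have hρε : 0 < ρ * ε := mul_pos (by linarith) hε0
    have hn : (m : ℝ) + 1 ≤ (1 + ρ * ε) * Y := by linarith
    have hνv : 1 + ρ * ε ≤ v := by
      have : ρ * ε ≤ (5 + v) * 0.22 := by gcongr
      linarith
    have hνL : (1 + ρ * ε) * Y ≤ L := by
      calc (1 + ρ * ε) * Y ≤ v * Y := by gcongr
        _ = L := by rw [hYd]; field_simp
    refine finish_core s t hs ht M N hN m 2 (1 + ρ * ε) Y (dS s t) _ (by norm_num) hm1 hm0 q1 q2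
      (by linarith) (by linarith) hY0 hd hdY (by linarith) hn ?_
    have hkey : (2 * (betaS s : ℝ) + 1) * (ρ * ε) ≤ 2 * ℓ * Y * ε := by
      have a1 : ρ * (2 * (betaS s : ℝ) + 1) / (2 * ℓ) ≤ g ^ 3 := by
        have a0 : 0 ≤ ρ * (2 * (betaS s : ℝ) + 1) / (2 * ℓ) := by
          have : 0 < ρ := by linarith
          positivity
        rw [← Real.rpow_le_rpow_iff a0 (by positivity) (by norm_num : (0 : ℝ) < 4 / 3)]
        refine (k5.trans hL).trans (le_of_eq ?_)
        rw [hLd, hg, ← Real.exp_nat_mul, ← Real.exp_mul]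
        congr 1; push_cast; ring
      have a2 := a1.trans hYg
      rw [div_le_iff₀ (by positivity)] at a2
      have a3 := mul_le_mul_of_nonneg_right a2 hε0.le
      linarith
    rw [← hr, hrexp]
    have hν : (1 + ρ * ε) ^ (2 * betaS s + 1) ≤ Real.exp (ρ * ε) ^ (2 * betaS s + 1) := by
      gcongr
      linarith [Real.add_one_le_exp (ρ * ε)]
    calc 2 * (1 + ρ * ε) ^ (2 * betaS s + 1) * Real.exp ℓ ^ (2 * m + 1)
        ≤ 2 * Real.exp (ρ * ε) ^ (2 * betaS s + 1) * Real.exp ℓ ^ (2 * m + 1) := by gcongr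
      _ = 2 * Real.exp ((2 * betaS s + 1) * (ρ * ε) + (2 * m + 1) * ℓ) := by
        rw [← Real.exp_nat_mul, ← Real.exp_nat_mul, mul_assoc, ← Real.exp_add]; push_cast; rfl
      _ ≤ 2 * Real.exp ((2 * betaS s + 1) * ℓ + 2 * ℓ * Y * (1 + ρ * ε)) := by
        have : 2 * (m : ℝ) * ℓ ≤ 2 * (Y * (1 + (ρ - 1) * ε) + betaS s) * ℓ := by gcongr
        refine mul_le_mul_of_nonneg_left (Real.exp_le_exp.2 ?_) (by norm_num)
        linarith
      _ = _ := by
        rw [← Real.exp_nat_mul, Real.exp_add]; push_cast; ring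

theorem rational_approx_exp_special (s t : ℤ) (hs : s ≠ 0) (ht : 0 < t)
    (hst : Int.gcd s t = 1) (M N : ℤ) (hM : M ≠ 0)
    (hN : (N : ℝ) ≥ Real.exp (logN2 s t)) :
    1 < |Real.exp ((s : ℝ) / (t : ℝ)) - (M : ℝ) / (N : ℝ)| * c2S s t *
      (N : ℝ) ^ (2 + 2 * Real.log (|(s : ℝ)| / alphaS s)
        * (1 + rhoS s t * epsN (N : ℝ)) / Real.log (Real.log (N : ℝ))) *
      (Real.log (N : ℝ) / Real.log (Real.log (N : ℝ))) ^ (2 * betaS s + 1) := by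
  obtain ⟨k1, k2, k3, k4, k5⟩ := logN2_facts s t
  have hN0 : (0 : ℝ) < N := lt_of_lt_of_le (Real.exp_pos _) hN
  have hNZ : 0 < N := by exact_mod_cast hN0
  have hL : logN2 s t ≤ Real.log N := by
    rw [Real.le_log_iff_exp_le hN0]; exact hN
  have hL0 : 0 < Real.log N := lt_of_lt_of_le (Real.exp_pos _) (k2.trans hL)
  have hv : 4 * Real.exp 1 ≤ Real.log (Real.log N) := by
    rw [Real.le_log_iff_exp_le hL0]; exact k2.trans hL
  have hexpv : Real.exp (Real.log (Real.log N)) = Real.log N := Real.exp_log hL0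
  have hNv : (N : ℝ) = Real.exp (Real.exp (Real.log (Real.log N))) := by
    rw [hexpv, Real.exp_log hN0]
  have hLv : logN2 s t ≤ Real.exp (Real.log (Real.log N)) := by rw [hexpv]; exact hL
  have hv0 : 0 < Real.log (Real.log N) := lt_of_lt_of_le (by positivity) hv
  have main := main_core s t hs ht M N hNZ _ hv hNv hLv
  have hd := (dS_facts s t hs ht _ hv hLv).1
  have hc := c2S_ge s t ht hd
  rw [hexpv] at main
  have hpow : (N : ℝ) ^ (2 + 2 * Real.log (|(s : ℝ)| / alphaS s)
        * (1 + rhoS s t * epsN (N : ℝ)) / Real.log (Real.log (N : ℝ)))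
      = (N : ℝ) ^ 2 * Real.exp (2 * Real.log (|(s : ℝ)| / alphaS s) *
        (Real.log N / Real.log (Real.log N))
          * (1 + rhoS s t * (Real.log (Real.log (Real.log N)) / Real.log (Real.log N)))) := by
    rw [Real.rpow_add hN0, Real.rpow_def_of_pos hN0 (2 * _ * _ / _), Real.rpow_two]
    unfold epsN
    congr 2
    ring
  rw [hpow]
  refine lt_of_lt_of_le main ?_
  gcongr
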